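/- arXiv:math/0602168 — 3 statements merged into one kernel-verified Lean document; each statement's English description precedes it below -/
import Mathlib

section
/- Let j_a and j_b be compatible positive complex structures on (E, ω). Then the sesquilinear pairing Λ^{n,0}_{j_b}E* × Λ^{n,0}_{j_a}E* → ℂ defined by (α_b, α_a) ↦ α_b ∧ ᾱ_a / ω^{∧n} is nondegenerate: if α_b ∧ ᾱ_a / ω^{∧n} = 0 for all α_a then α_b = 0, and if it vanishes for all α_b then α_a = 0. -/
open Complex

noncomputable section

variable {E : Type*} [AddCommGroup E] [Module ℝ E]

/-- `j` is a complex structure on `E`: `j ∘ j = -id`. -/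
def IsCplxStruct (j : E →ₗ[ℝ] E) : Prop := ∀ x : E, j (j x) = -x

/-- `j` is compatible with the symplectic form `ω`. -/
def OmCompat (ω : E [⋀^Fin 2]→ₗ[ℝ] ℝ) (j : E →ₗ[ℝ] E) : Prop :=
  ∀ x y : E, ω ![j x, j y] = ω ![x, y]

/-- `j` is positive with respect to `ω`. -/
def OmPos (ω : E [⋀^Fin 2]→ₗ[ℝ] ℝ) (j : E →ₗ[ℝ] E) : Prop :=
  ∀ x : E, x ≠ 0 → 0 < ω ![x, j x]

/-- `ω` is nondegenerate. -/
def OmNondeg (ω : E [⋀^Fin 2]→ₗ[ℝ] ℝ) : Prop :=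
  ∀ x : E, (∀ y : E, ω ![x, y] = 0) → x = 0

/-- The complex conjugate of a `ℂ`-valued alternating form. -/
def conjAlt {p : ℕ} (α : E [⋀^Fin p]→ₗ[ℝ] ℂ) : E [⋀^Fin p]→ₗ[ℝ] ℂ :=
  Complex.conjAe.toLinearMap.compAlternatingMap α

/-- Wedge product of `ℂ`-valued alternating forms. -/
def wedgeC {p q : ℕ} (α : E [⋀^Fin p]→ₗ[ℝ] ℂ) (β : E [⋀^Fin q]→ₗ[ℝ] ℂ) :
    E [⋀^Fin (p + q)]→ₗ[ℝ] ℂ :=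
  ((LinearMap.mul' ℝ ℂ).compAlternatingMap (α.domCoprod β)).domDomCongr finSumFinEquiv

/-- The complexification of a real-valued alternating form. -/
def cplxForm {p : ℕ} (ω : E [⋀^Fin p]→ₗ[ℝ] ℝ) : E [⋀^Fin p]→ₗ[ℝ] ℂ :=
  (Algebra.linearMap ℝ ℂ).compAlternatingMap ω

/-- `ω^{∧ m}`. -/
def omPow (ω : E [⋀^Fin 2]→ₗ[ℝ] ℝ) : (m : ℕ) → E [⋀^Fin (2 * m)]→ₗ[ℝ] ℂ
  | 0 => (AlternatingMap.constOfIsEmpty ℝ E (Fin 0) 1).domDomCongr (finCongr (by ring))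
  | (m + 1) => (wedgeC (cplxForm ω) (omPow ω m)).domDomCongr (finCongr (by ring))

/-- `ω^{∧ n}`, reindexed by `Fin (n + n)`. -/
def topPow (ω : E [⋀^Fin 2]→ₗ[ℝ] ℝ) (n : ℕ) : E [⋀^Fin (n + n)]→ₗ[ℝ] ℂ :=
  (omPow ω n).domDomCongr (finCongr (by ring))

/-- `Λ^{n,0}_j E*`: the space of `ℂ`-valued alternating `p`-forms `α` with
`α (j v₁, v₂, …, v_p) = i • α (v₁, …, v_p)`. -/
def Lam (j : E →ₗ[ℝ] E) (p : ℕ) : Submodule ℂ (E [⋀^Fin p]→ₗ[ℝ] ℂ) where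
  carrier := {α | ∀ (v : Fin p → E) (i : Fin p), (i : ℕ) = 0 →
    α (Function.update v i (j (v i))) = Complex.I * α v}
  add_mem' := by
    intro a b ha hb v i hi
    simp only [AlternatingMap.add_apply, ha v i hi, hb v i hi]
    ring
  zero_mem' := by
    intro v i hi
    simp
  smul_mem' := by
    intro c a ha v i hi
    simp only [AlternatingMap.smul_apply, ha v i hi, smul_eq_mul]
    ring

/-- The scalar `α ∧ β̄ / ω^{∧ n}`. -/
def pairing (ω : E [⋀^Fin 2]→ₗ[ℝ] ℝ) (n : ℕ) (α β : E [⋀^Fin n]→ₗ[ℝ] ℂ) : ℂ :=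
  letI := Classical.propDecidable (∃ c : ℂ, wedgeC α (conjAlt β) = c • topPow ω n)
  if h : ∃ c : ℂ, wedgeC α (conjAlt β) = c • topPow ω n then h.choose else 0

open MultilinearMap in
theorem AlternatingMap.domDomCongr_alternatization {ι κ F : Type*} [Fintype ι] [Fintype κ]
    [DecidableEq ι] [DecidableEq κ] [AddCommGroup F] [Module ℝ F] (e : ι ≃ κ)
    (m : MultilinearMap ℝ (fun _ : ι => E) F) :
    (alternatization m).domDomCongr e = alternatization (m.domDomCongr e) := by
  ext v
  simp only [AlternatingMap.domDomCongr_apply, alternatization_apply, domDomCongr_apply]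
  refine Fintype.sum_equiv e.permCongr _ _ fun σ => ?_
  simp [Equiv.Perm.sign_permCongr]

/-- The product of two multilinear forms in independent variables. -/
def mulForm {p q : ℕ} (a : MultilinearMap ℝ (fun _ : Fin p => E) ℂ)
    (b : MultilinearMap ℝ (fun _ : Fin q => E) ℂ) :
    MultilinearMap ℝ (fun _ : Fin (p + q) => E) ℂ :=
  ((LinearMap.mul' ℝ ℂ).compMultilinearMap (a.domCoprod b)).domDomCongr finSumFinEquiv

theorem mulForm_apply {p q : ℕ} (a : MultilinearMap ℝ (fun _ : Fin p => E) ℂ)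
    (b : MultilinearMap ℝ (fun _ : Fin q => E) ℂ) (v : Fin (p + q) → E) :
    mulForm a b v = a (fun i => v (Fin.castAdd q i)) * b (fun i => v (Fin.natAdd p i)) := by
  simp [mulForm]

theorem wedgeC_alternatization {p q : ℕ} (a : MultilinearMap ℝ (fun _ : Fin p => E) ℂ)
    (b : MultilinearMap ℝ (fun _ : Fin q => E) ℂ) :
    wedgeC (MultilinearMap.alternatization a) (MultilinearMap.alternatization b) =
      MultilinearMap.alternatization (mulForm a b) := by
  rw [wedgeC, ← MultilinearMap.domCoprod_alternization,
    ← LinearMap.compMultilinearMap_alternatization,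
    AlternatingMap.domDomCongr_alternatization, mulForm]

/-- The wedge product `θ₁ ∧ ⋯ ∧ θₚ` of `ℂ`-valued linear forms. -/
def wedgeForms {p : ℕ} (θ : Fin p → E →ₗ[ℝ] ℂ) : E [⋀^Fin p]→ₗ[ℝ] ℂ :=
  MultilinearMap.alternatization ((MultilinearMap.mkPiAlgebra ℝ (Fin p) ℂ).compLinearMap θ)

theorem wedgeForms_apply {p : ℕ} (θ : Fin p → E →ₗ[ℝ] ℂ) (v : Fin p → E) :
    wedgeForms θ v = (Matrix.of fun k i => θ i (v k)).det := by
  simp [wedgeForms, MultilinearMap.alternatization_apply, Matrix.det_apply]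

theorem conjAlt_wedgeForms {p : ℕ} (θ : Fin p → E →ₗ[ℝ] ℂ) :
    conjAlt (wedgeForms θ) = wedgeForms fun i => Complex.conjAe.toLinearMap ∘ₗ θ i := by
  ext v
  simp only [conjAlt, LinearMap.compAlternatingMap_apply, wedgeForms_apply]
  exact (Complex.conjAe : ℂ →ₐ[ℝ] ℂ).toRingHom.map_det _

theorem wedgeC_wedgeForms {p q : ℕ} (θ : Fin p → E →ₗ[ℝ] ℂ) (η : Fin q → E →ₗ[ℝ] ℂ) :
    wedgeC (wedgeForms θ) (wedgeForms η) = wedgeForms (Fin.append θ η) := by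
  rw [wedgeForms, wedgeForms, wedgeC_alternatization, wedgeForms]
  congr 1
  ext v
  simp [mulForm_apply, Fin.prod_univ_add]

theorem wedgeC_smul_smul {p q : ℕ} (c d : ℂ) (α : E [⋀^Fin p]→ₗ[ℝ] ℂ)
    (β : E [⋀^Fin q]→ₗ[ℝ] ℂ) : wedgeC (c • α) (d • β) = (c * d) • wedgeC α β := by
  ext v
  simp only [wedgeC, AlternatingMap.domDomCongr_apply, LinearMap.compAlternatingMap_apply,
    AlternatingMap.smul_apply, AlternatingMap.domCoprod_apply, sum_apply, map_sum,
    Finset.smul_sum]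
  refine Finset.sum_congr rfl fun σ _ => ?_
  induction σ using Quotient.inductionOn' with
  | h σ =>
    rcases Int.units_eq_one_or (Equiv.Perm.sign σ) with h | h <;>
      simp [AlternatingMap.domCoprod.summand_mk'', h] <;> ring

theorem conjAlt_smul {p : ℕ} (c : ℂ) (α : E [⋀^Fin p]→ₗ[ℝ] ℂ) :
    conjAlt (c • α) = (starRingEnd ℂ c) • conjAlt α := by
  ext v
  simp [conjAlt]

theorem wedgeForms_ne_zero [FiniteDimensional ℝ E] {p : ℕ} (hdim : Module.finrank ℝ E = p)
    {θ : Fin p → E →ₗ[ℝ] ℂ} (hθ : LinearIndependent ℂ θ) : wedgeForms θ ≠ 0 := by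
  intro h
  let e := Module.finBasisOfFinrankEq ℝ E hdim
  have h0 : (Matrix.of fun k i => θ i (e k)).det = 0 := by
    rw [← wedgeForms_apply, h, AlternatingMap.zero_apply]
  obtain ⟨c, hc, hc0⟩ := Matrix.exists_mulVec_eq_zero_iff.mpr h0
  refine hc (funext (Fintype.linearIndependent_iff.mp hθ c ?_))
  refine e.ext fun k => ?_
  have := congrFun hc0 k
  simpa [Matrix.mulVec, dotProduct, mul_comm] using this

theorem AlternatingMap.eq_smul_of_card_eq_finrank [FiniteDimensional ℝ E] {p : ℕ}
    (hdim : Module.finrank ℝ E = p) {g : E [⋀^Fin p]→ₗ[ℝ] ℂ} (hg : g ≠ 0)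
    (f : E [⋀^Fin p]→ₗ[ℝ] ℂ) : ∃ c : ℂ, f = c • g := by
  let e := Module.finBasisOfFinrankEq ℝ E hdim
  have key (f g : E [⋀^Fin p]→ₗ[ℝ] ℂ) (h : f e = g e) : f = g := by
    refine Module.Basis.ext_alternating e fun i hi => ?_
    let σ : Equiv.Perm (Fin p) := Equiv.ofBijective i (Finite.injective_iff_bijective.1 hi)
    change f (e ∘ σ) = g (e ∘ σ)
    rw [AlternatingMap.map_perm, AlternatingMap.map_perm, h]
  have hge : g e ≠ 0 := fun h => hg (key g 0 (by simpa using h))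
  exact ⟨f e / g e, key _ _ (by simp [hge])⟩

theorem isCplxStruct_exists_frame {n : ℕ} [FiniteDimensional ℝ E] {j : E →ₗ[ℝ] E}
    (hj : IsCplxStruct j) (hdim : Module.finrank ℝ E = 2 * n) :
    ∃ θ : Fin n → E →ₗ[ℝ] ℂ, (∀ i x, θ i (j x) = I * θ i x) ∧ LinearIndependent ℂ θ ∧
      wedgeForms θ ∈ Lam j n ∧ ∀ α ∈ Lam j n, ∃ c : ℂ, α = c • wedgeForms θ := by
  let φ : ℂ →ₐ[ℝ] Module.End ℝ E := Complex.lift ⟨j, by ext x; simp [hj x]⟩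
  let : Module ℂ E := Module.compHom E φ.toRingHom
  have hsm (c : ℂ) (x : E) : c • x = φ c x := rfl
  have : IsScalarTower ℝ ℂ E := ⟨fun r c x => by simp [hsm]⟩
  have hI (x : E) : I • x = j x := by simp [hsm, φ]
  have : FiniteDimensional ℂ E := FiniteDimensional.right ℝ ℂ E
  have hn : Module.finrank ℂ E = n := by
    have := Module.finrank_mul_finrank ℝ ℂ E
    rw [Complex.finrank_real_complex] at this
    omega
  let b := Module.finBasisOfFinrankEq ℂ E hn
  let θ : Fin n → E →ₗ[ℝ] ℂ := fun i => (b.coord i).restrictScalars ℝ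
  have hθ (i x) : θ i (j x) = I * θ i x := by
    simp [θ, ← hI]
  have hlam (α) (hα : α ∈ Lam j n) (v : Fin n → E) (i : Fin n) (x : E) :
      α (Function.update v i (j x)) = I * α (Function.update v i x) := by
    have hzero (w : Fin n → E) (i : Fin n) (hi : (i : ℕ) = 0) (x : E) :
        α (Function.update w i (j x)) = I * α (Function.update w i x) := by
      simpa using hα (Function.update w i x) i hi
    have hn0 : 0 < n := i.pos
    by_cases hi : i = ⟨0, hn0⟩
    · exact hzero v i (by simp [hi]) x
    · have hswap (y : E) : α (Function.update v i y) =
          -α (Function.update (v ∘ Equiv.swap i ⟨0, hn0⟩) ⟨0, hn0⟩ y) := by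
        rw [← α.map_swap _ hi, Function.update_comp_equiv, Function.comp_assoc]
        congr 1
        simp [Function.comp_def]
      rw [hswap, hswap, hzero _ _ rfl, mul_neg]
  refine ⟨θ, hθ, ?_, ?_, fun α hα => ?_⟩
  · rw [Fintype.linearIndependent_iff]
    intro g hg i
    have := LinearMap.congr_fun hg (b i)
    simpa [θ, Finsupp.single_apply] using this
  · intro v i _
    rw [wedgeForms_apply, wedgeForms_apply]
    set M : Matrix (Fin n) (Fin n) ℂ := Matrix.of fun k l => θ l (v k)
    rw [← Matrix.updateRow_eq_self M i, ← Matrix.det_updateRow_smul]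
    congr 1
    ext k l
    rcases eq_or_ne k i with rfl | hk
    · simp [hθ, M]
    · simp [hk, M]
  · let α' : E [⋀^Fin n]→ₗ[ℂ] ℂ :=
      { toFun := α
        map_update_add' := fun v i x y => by
          convert α.map_update_add v i x y
        map_update_smul' := by
          intro inst v i c x
          obtain rfl : inst = instDecidableEqFin n := Subsingleton.elim _ _
          have hc : c • x = c.re • x + c.im • j x := by simp [hsm, φ, Complex.liftAux_apply]
          change α (Function.update v i (c • x)) = c • α (Function.update v i x)
          rw [hc, α.map_update_add, α.map_update_smul, α.map_update_smul, hlam α hα]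
          apply Complex.ext <;> simp [sub_eq_add_neg]
        map_eq_zero_of_eq' := fun v i k h hik => α.map_eq_zero_of_eq v h hik }
    refine ⟨α' b, ?_⟩
    ext v
    change α' v = α' b • wedgeForms θ v
    rw [wedgeForms_apply, ← Matrix.det_transpose]
    exact congrArg (fun f => f v) (α'.eq_smul_basis_det b)

/-- An alternating two-form as a bilinear map. -/
def omBilin (ω : E [⋀^Fin 2]→ₗ[ℝ] ℝ) : E →ₗ[ℝ] E →ₗ[ℝ] ℝ :=
  have h0 (x y z : E) : Function.update ![x, y] 0 z = ![z, y] := by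
    funext i; fin_cases i <;> rfl
  have h1 (x y z : E) : Function.update ![x, y] 1 z = ![x, z] := by
    funext i; fin_cases i <;> rfl
  LinearMap.mk₂ ℝ (fun x y => ω ![x, y])
    (fun x x' y => by simpa only [h0] using ω.map_update_add ![x, y] 0 x x')
    (fun c x y => by simpa only [h0] using ω.map_update_smul ![x, y] 0 c x)
    (fun x y y' => by simpa only [h1] using ω.map_update_add ![x, y] 1 y y')
    (fun c x y => by simpa only [h1] using ω.map_update_smul ![x, y] 1 c y)

theorem omBilin_apply (ω : E [⋀^Fin 2]→ₗ[ℝ] ℝ) (x y : E) : omBilin ω x y = ω ![x, y] := rfl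

theorem omBilin_self (ω : E [⋀^Fin 2]→ₗ[ℝ] ℝ) (x : E) : omBilin ω x x = 0 :=
  ω.map_eq_zero_of_eq _ (i := 0) (j := 1) rfl (by simp)

theorem omBilin_swap (ω : E [⋀^Fin 2]→ₗ[ℝ] ℝ) (x y : E) :
    omBilin ω x y = -omBilin ω y x := by
  have h := omBilin_self ω (x + y)
  simp only [map_add, LinearMap.add_apply, omBilin_self] at h
  linarith

theorem OmCompat.omBilin_map {ω : E [⋀^Fin 2]→ₗ[ℝ] ℝ} {j : E →ₗ[ℝ] E} (hc : OmCompat ω j)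
    (hj : IsCplxStruct j) (x y : E) : omBilin ω x (j y) = -omBilin ω (j x) y := by
  rw [omBilin_apply, ← hc x (j y), hj, ← omBilin_apply, map_neg]

theorem exists_omBilin_eq [FiniteDimensional ℝ E] {ω : E [⋀^Fin 2]→ₗ[ℝ] ℝ} (hnd : OmNondeg ω)
    (f : E →ₗ[ℝ] ℝ) : ∃ u, omBilin ω u = f := by
  have hinj : Function.Injective (omBilin ω) := by
    rw [injective_iff_map_eq_zero]
    exact fun x hx => hnd x fun y => LinearMap.congr_fun hx y
  exact (LinearMap.injective_iff_surjective_of_finrank_eq_finrank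
    (Subspace.dual_finrank_eq (K := ℝ) (V := E)).symm).mp hinj f

theorem eq_zero_of_types_opposite [FiniteDimensional ℝ E] {ω : E [⋀^Fin 2]→ₗ[ℝ] ℝ}
    (hnd : OmNondeg ω) {ja jb : E →ₗ[ℝ] E} (hja : IsCplxStruct ja) (hjb : IsCplxStruct jb)
    (hca : OmCompat ω ja) (hcb : OmCompat ω jb) (hpa : OmPos ω ja) (hpb : OmPos ω jb)
    {φ : E →ₗ[ℝ] ℂ} (hb : ∀ x, φ (jb x) = I * φ x) (ha : ∀ x, φ (ja x) = -I * φ x) : φ = 0 := by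
  obtain ⟨u, hu⟩ := exists_omBilin_eq hnd (Complex.reLm ∘ₗ φ)
  have hre (x : E) : (φ x).re = omBilin ω u x := by rw [hu]; rfl
  have him_b (x : E) : (φ x).im = omBilin ω (jb u) x := by
    have := hre (jb x)
    rw [hb, hcb.omBilin_map hjb] at this
    simpa using this
  have him_a (x : E) : (φ x).im = -omBilin ω (ja u) x := by
    have := hre (ja x)
    rw [ha, hca.omBilin_map hja] at this
    simpa using this
  have hu0 : u = 0 := by
    by_contra hu0
    have h1 := hpa u hu0
    have h2 := hpb u hu0
    rw [← omBilin_apply, omBilin_swap] at h1 h2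
    have h3 := him_a u
    have h4 := him_b u
    linarith
  subst hu0
  ext1 x
  apply Complex.ext
  · simp [hre]
  · simp [him_b]

theorem linearIndependent_append_conj [FiniteDimensional ℝ E] {ω : E [⋀^Fin 2]→ₗ[ℝ] ℝ}
    (hnd : OmNondeg ω) {ja jb : E →ₗ[ℝ] E} (hja : IsCplxStruct ja) (hjb : IsCplxStruct jb)
    (hca : OmCompat ω ja) (hcb : OmCompat ω jb) (hpa : OmPos ω ja) (hpb : OmPos ω jb) {n : ℕ}
    {θ η : Fin n → E →ₗ[ℝ] ℂ} (hθ : ∀ i x, θ i (jb x) = I * θ i x)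
    (hη : ∀ i x, η i (ja x) = I * η i x) (hθi : LinearIndependent ℂ θ)
    (hηi : LinearIndependent ℂ η) :
    LinearIndependent ℂ (Fin.append θ fun i => Complex.conjAe.toLinearMap ∘ₗ η i) := by
  rw [Fintype.linearIndependent_iff] at hθi hηi ⊢
  intro g hg
  rw [Fin.sum_univ_add] at hg
  simp only [Fin.append_left, Fin.append_right] at hg
  set φ := ∑ i, g (Fin.castAdd n i) • θ i with hφ
  have hφ' (x : E) : φ x = -∑ i, g (Fin.natAdd n i) * starRingEnd ℂ (η i x) := by
    rw [eq_neg_of_add_eq_zero_left hg]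
    simp
  have h0 : φ = 0 := by
    refine eq_zero_of_types_opposite hnd hja hjb hca hcb hpa hpb (fun x => ?_) fun x => ?_
    · simp only [hφ, LinearMap.sum_apply, LinearMap.smul_apply, hθ, smul_eq_mul, Finset.mul_sum]
      exact Finset.sum_congr rfl fun i _ => by ring
    · simp only [hφ', hη, map_mul, Complex.conj_I, ← Finset.sum_neg_distrib, Finset.mul_sum]
      exact Finset.sum_congr rfl fun i _ => by ring
  have h1 : ∑ i, starRingEnd ℂ (g (Fin.natAdd n i)) • η i = 0 := by
    ext1 x
    have h2 := hφ' x
    rw [h0] at h2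
    have h3 := congrArg (starRingEnd ℂ) h2
    simpa using h3.symm
  refine Fin.addCases (hθi _ h0) fun i => ?_
  simpa using hηi _ h1 i

theorem exists_unitary_frame [FiniteDimensional ℝ E] {ω : E [⋀^Fin 2]→ₗ[ℝ] ℝ} {j : E →ₗ[ℝ] E}
    (hj : IsCplxStruct j) (hc : OmCompat ω j) (hp : OmPos ω j) {n : ℕ}
    (hn : 2 * n ≤ Module.finrank ℝ E) :
    ∃ e : Fin n → E, ∀ i k, omBilin ω (e i) (e k) = 0 ∧
      omBilin ω (e i) (j (e k)) = if i = k then 1 else 0 := by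
  induction n with
  | zero => exact ⟨0, fun i => i.elim0⟩
  | succ n ih =>
    obtain ⟨e, he⟩ := ih (by omega)
    let f : E →ₗ[ℝ] (Fin n → ℝ) × (Fin n → ℝ) :=
      (LinearMap.pi fun k => omBilin ω (e k)).prod (LinearMap.pi fun k => omBilin ω (j (e k)))
    have hf : LinearMap.ker f ≠ ⊥ := by
      apply LinearMap.ker_ne_bot_of_finrank_lt
      simp
      omega
    obtain ⟨x, hx, hx0⟩ := Submodule.exists_mem_ne_zero_of_ne_bot hf
    have hx1 (k) : omBilin ω (e k) x = 0 := congrFun (congrArg Prod.fst hx) k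
    have hx2 (k) : omBilin ω (j (e k)) x = 0 := congrFun (congrArg Prod.snd hx) k
    have hd : 0 < omBilin ω x (j x) := hp x hx0
    set r := (√(omBilin ω x (j x)))⁻¹ with hr
    have hrr : r * (r * omBilin ω x (j x)) = 1 := by
      rw [hr, ← mul_assoc, ← mul_inv, Real.mul_self_sqrt hd.le, inv_mul_cancel₀ hd.ne']
    refine ⟨Fin.cons (r • x) e, fun i k => ?_⟩
    refine Fin.cases ?_ (fun i => ?_) i <;> refine Fin.cases ?_ (fun k => ?_) k
    · simp [omBilin_self, hrr]
    · rw [Fin.cons_zero, Fin.cons_succ, omBilin_swap, omBilin_swap ω _ (j _)]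
      simp [hx1, hx2, (Fin.succ_ne_zero k).symm]
    · rw [Fin.cons_zero, Fin.cons_succ, hc.omBilin_map hj]
      simp [hx1, hx2]
    · simp [he]

/-- The indexing of `2 * m` arguments by `m` consecutive pairs. -/
def pairIdx (m : ℕ) : Fin m × Fin 2 ≃ Fin (2 * m) :=
  finProdFinEquiv.trans (finCongr (mul_comm m 2))

/-- The product of `m` copies of a bilinear form in independent variables. -/
def powForm (b : MultilinearMap ℝ (fun _ : Fin 2 => E) ℂ) :
    (m : ℕ) → MultilinearMap ℝ (fun _ : Fin (2 * m) => E) ℂ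
  | 0 => (MultilinearMap.constOfIsEmpty ℝ (fun _ : Fin 0 => E) 1).domDomCongr
      (finCongr (by ring))
  | (m + 1) => (mulForm b (powForm b m)).domDomCongr (finCongr (by ring))

theorem powForm_apply (b : MultilinearMap ℝ (fun _ : Fin 2 => E) ℂ) (m : ℕ)
    (v : Fin (2 * m) → E) : powForm b m v = ∏ k, b fun i => v (pairIdx m (k, i)) := by
  induction m with
  | zero => simp [powForm]
  | succ m ih =>
    rw [powForm, MultilinearMap.domDomCongr_apply, mulForm_apply, ih, Fin.prod_univ_succ]
    congr 1
    refine Finset.prod_congr rfl fun k _ =>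
      congrArg b (funext fun i => congrArg v (Fin.ext ?_))
    simp [pairIdx, finProdFinEquiv]
    ring

theorem omPow_eq_alternatization {ω : E [⋀^Fin 2]→ₗ[ℝ] ℝ}
    {b : MultilinearMap ℝ (fun _ : Fin 2 => E) ℂ}
    (hb : cplxForm ω = MultilinearMap.alternatization b) (m : ℕ) :
    omPow ω m = MultilinearMap.alternatization (powForm b m) := by
  induction m with
  | zero =>
    rw [omPow, powForm, ← AlternatingMap.domDomCongr_alternatization]
    congr 1
    ext v
    simp [MultilinearMap.alternatization_apply]
  | succ m ih =>
    rw [omPow, powForm, ← AlternatingMap.domDomCongr_alternatization, ih, hb,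
      wedgeC_alternatization]

theorem Equiv.Perm.exists_eq_prodCongrLeft {n : ℕ} {τ : Equiv.Perm (Fin n × Fin 2)}
    (h : ∀ k, (τ (k, 0)).2 = 0 ∧ (τ (k, 1)).2 = 1 ∧ (τ (k, 0)).1 = (τ (k, 1)).1) :
    ∃ κ : Equiv.Perm (Fin n), τ = Equiv.prodCongrLeft fun _ => κ := by
  have h0 (k) : τ (k, 0) = ((τ (k, 0)).1, 0) := Prod.ext rfl (h k).1
  have h1 (k) : τ (k, 1) = ((τ (k, 0)).1, 1) := Prod.ext (h k).2.2.symm (h k).2.1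
  have hinj : Function.Injective fun k => (τ (k, 0)).1 := fun k l hkl => by
    have : τ (k, 0) = τ (l, 0) := by rw [h0 k, h0 l]; exact congrArg (·, 0) hkl
    simpa using this
  refine ⟨Equiv.ofBijective _ (Finite.injective_iff_bijective.1 hinj), ?_⟩
  ext1 ⟨k, i⟩
  fin_cases i
  · exact h0 k
  · exact h1 k

theorem alternatization_powForm_ne_zero {n : ℕ} {b : MultilinearMap ℝ (fun _ : Fin 2 => E) ℂ}
    {v : Fin n × Fin 2 → E}
    (hb : ∀ p : Fin 2 → Fin n × Fin 2, b (fun i => v (p i)) =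
      if (p 0).2 = 0 ∧ (p 1).2 = 1 ∧ (p 0).1 = (p 1).1 then 1 else 0) :
    MultilinearMap.alternatization (powForm b n) ≠ 0 := by
  intro h
  have hsum : (MultilinearMap.alternatization (powForm b n)).domDomCongr (pairIdx n).symm v = 0 := by
    simp [h]
  rw [AlternatingMap.domDomCongr_alternatization, MultilinearMap.alternatization_apply] at hsum
  have hterm (τ : Equiv.Perm (Fin n × Fin 2)) :
      Equiv.Perm.sign τ • ((powForm b n).domDomCongr (pairIdx n).symm).domDomCongr τ v =
        if ∀ k, (τ (k, 0)).2 = 0 ∧ (τ (k, 1)).2 = 1 ∧ (τ (k, 0)).1 = (τ (k, 1)).1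
          then (1 : ℂ) else 0 := by
    simp only [MultilinearMap.domDomCongr_apply, powForm_apply, Equiv.symm_apply_apply, hb]
    split_ifs with hτ
    · obtain ⟨κ, rfl⟩ := Equiv.Perm.exists_eq_prodCongrLeft hτ
      simp [Equiv.Perm.sign_prodCongrLeft]
    · push Not at hτ
      obtain ⟨k, hk⟩ := hτ
      rw [Finset.prod_eq_zero (Finset.mem_univ k) (if_neg (by tauto)), smul_zero]
  simp only [hterm, Finset.sum_boole] at hsum
  rw [Nat.cast_eq_zero, Finset.card_eq_zero] at hsum
  exact Finset.eq_empty_iff_forall_notMem.mp hsum 1 (by simp)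

theorem topPow_ne_zero [FiniteDimensional ℝ E] {ω : E [⋀^Fin 2]→ₗ[ℝ] ℝ} {j : E →ₗ[ℝ] E}
    (hj : IsCplxStruct j) (hc : OmCompat ω j) (hp : OmPos ω j) {n : ℕ}
    (hdim : Module.finrank ℝ E = 2 * n) : topPow ω n ≠ 0 := by
  obtain ⟨e, he⟩ := exists_unitary_frame hj hc hp hdim.ge
  have he0 (i k) := (he i k).1
  have he1 (i k) := (he i k).2
  have he2 (i k) : omBilin ω (j (e i)) (e k) = -if i = k then 1 else 0 := by
    rw [omBilin_swap, he1]
    simp [eq_comm]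
  have he3 (i k) : omBilin ω (j (e i)) (j (e k)) = 0 := (hc _ _).trans (he0 i k)
  let v : Fin n × Fin 2 → E := fun p => ![e p.1, j (e p.1)] p.2
  let ξ : Fin n × Fin 2 → E →ₗ[ℝ] ℝ := fun p => ![-omBilin ω (j (e p.1)), omBilin ω (e p.1)] p.2
  have hξ (p q) : ξ p (v q) = if p = q then 1 else 0 := by
    obtain ⟨i, a⟩ := p
    obtain ⟨k, c⟩ := q
    fin_cases a <;> fin_cases c <;> simp [ξ, v, he0, he1, he2, he3]
  have hv : LinearIndependent ℝ v := by
    rw [Fintype.linearIndependent_iff]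
    intro g hg p
    simpa [hξ] using congrArg (ξ p) hg
  have hcard : Fintype.card (Fin n × Fin 2) = Module.finrank ℝ E := by
    simp [hdim, mul_comm]
  let ξc : Fin n × Fin 2 → E →ₗ[ℝ] ℂ := fun p => Complex.ofRealLI.toLinearMap ∘ₗ ξ p
  have hξc (p q) : ξc p (v q) = if p = q then 1 else 0 := by
    simp [ξc, hξ, apply_ite Complex.ofReal]
  let b : MultilinearMap ℝ (fun _ : Fin 2 => E) ℂ :=
    ∑ k, (MultilinearMap.mkPiAlgebra ℝ (Fin 2) ℂ).compLinearMap fun i => ξc (k, i)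
  have hb : cplxForm ω = MultilinearMap.alternatization b := by
    have hb' (w : Fin 2 → E) :
        MultilinearMap.alternatization b w = ∑ k, wedgeForms (fun i => ξc (k, i)) w := by
      let ev : (E [⋀^Fin 2]→ₗ[ℝ] ℂ) →+ ℂ :=
        { toFun := fun f => f w, map_zero' := rfl, map_add' := fun _ _ => rfl }
      change ev (MultilinearMap.alternatization b) = _
      rw [map_sum, map_sum]
      rfl
    let B := basisOfLinearIndependentOfCardEqFinrank' v hv hcard
    have hB (p) : B p = v p := by simp [B]
    refine Module.Basis.ext_alternating B fun p _ => ?_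
    have hω : (fun i => v (p i)) = ![v (p 0), v (p 1)] := by
      funext i; fin_cases i <;> rfl
    have hω' : cplxForm ω (fun i => v (p i)) = omBilin ω (v (p 0)) (v (p 1)) := by
      rw [cplxForm, LinearMap.compAlternatingMap_apply, hω, ← omBilin_apply]
      rfl
    simp only [hB, hω', hb', wedgeForms_apply, Matrix.det_fin_two, Matrix.of_apply, hξc]
    obtain ⟨i, a⟩ := p 0
    obtain ⟨k, c⟩ := p 1
    fin_cases a <;> fin_cases c <;>
      simp [v, he0, he1, he2, he3, apply_ite Complex.ofReal, Finset.sum_ite_eq, eq_comm]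
  have hpow : omPow ω n ≠ 0 := by
    rw [omPow_eq_alternatization hb]
    refine alternatization_powForm_ne_zero (v := v) fun p => ?_
    simp only [b, sum_apply, MultilinearMap.compLinearMap_apply, MultilinearMap.mkPiAlgebra_apply,
      Fin.prod_univ_two, hξc]
    obtain ⟨i, a⟩ := p 0
    obtain ⟨k, c⟩ := p 1
    fin_cases a <;> fin_cases c <;> simp [eq_comm]
  intro h
  apply hpow
  ext w
  have := AlternatingMap.congr_fun h (w ∘ finCongr (by ring))
  simpa [topPow, Function.comp_def] using this

theorem wedgeC_conjAlt_eq_zero_of_pairing [FiniteDimensional ℝ E] {ω : E [⋀^Fin 2]→ₗ[ℝ] ℝ}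
    {n : ℕ} (hdim : Module.finrank ℝ E = 2 * n) (htop : topPow ω n ≠ 0)
    {α β : E [⋀^Fin n]→ₗ[ℝ] ℂ} (h : pairing ω n α β = 0) : wedgeC α (conjAlt β) = 0 := by
  have hex : ∃ c : ℂ, wedgeC α (conjAlt β) = c • topPow ω n :=
    AlternatingMap.eq_smul_of_card_eq_finrank (by omega) htop _
  rw [pairing, dif_pos hex] at h
  rw [hex.choose_spec, h, zero_smul]

/-- nondegeneracy of the sesquilinear pairing
`Λ^{n,0}_{j_b}E* × Λ^{n,0}_{j_a}E* → ℂ`, `(α_b, α_a) ↦ α_b ∧ ᾱ_a / ω^{∧n}`. -/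
theorem statement0 {E : Type*} [AddCommGroup E] [Module ℝ E] [FiniteDimensional ℝ E]
    (n : ℕ) (hn : 0 < n) (ω : E [⋀^Fin 2]→ₗ[ℝ] ℝ)
    (hdim : Module.finrank ℝ E = 2 * n) (hnd : OmNondeg ω)
    (ja jb : E →ₗ[ℝ] E) (hja : IsCplxStruct ja) (hjb : IsCplxStruct jb)
    (hca : OmCompat ω ja) (hcb : OmCompat ω jb)
    (hpa : OmPos ω ja) (hpb : OmPos ω jb) :
    (∀ αb ∈ Lam jb n, (∀ αa ∈ Lam ja n, pairing ω n αb αa = 0) → αb = 0) ∧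
    (∀ αa ∈ Lam ja n, (∀ αb ∈ Lam jb n, pairing ω n αb αa = 0) → αa = 0) := by
  obtain ⟨θ, hθ, hθi, hθm, hθs⟩ := isCplxStruct_exists_frame hjb hdim
  obtain ⟨η, hη, hηi, hηm, hηs⟩ := isCplxStruct_exists_frame hja hdim
  have htop := topPow_ne_zero hja hca hpa hdim
  have hw : wedgeC (wedgeForms θ) (conjAlt (wedgeForms η)) ≠ 0 := by
    rw [conjAlt_wedgeForms, wedgeC_wedgeForms]
    exact wedgeForms_ne_zero (by omega)
      (linearIndependent_append_conj hnd hja hjb hca hcb hpa hpb hθ hη hθi hηi)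
  have key (c d : ℂ) (h : pairing ω n (c • wedgeForms θ) (d • wedgeForms η) = 0) :
      c = 0 ∨ d = 0 := by
    have := wedgeC_conjAlt_eq_zero_of_pairing hdim htop h
    rw [conjAlt_smul, wedgeC_smul_smul, smul_eq_zero_iff_left hw] at this
    simpa using this
  refine ⟨fun αb hαb h => ?_, fun αa hαa h => ?_⟩
  · obtain ⟨c, rfl⟩ := hθs αb hαb
    have := key c 1 (h _ (Submodule.smul_mem _ _ hηm))
    simp_all
  · obtain ⟨d, rfl⟩ := hηs αa hαa
    have := key 1 d (h _ (Submodule.smul_mem _ _ hθm))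
    simp_all

end
end

section
/- Let j_a and j_b be compatible positive complex structures on (E, ω). Then there exists a unique ℂ-linear map Ψ_{j_a,j_b} : Λ^{n,0}_{j_a}E* → Λ^{n,0}_{j_b}E* such that Ψ_{j_a,j_b}(α) ∧ β̄ = α ∧ β̄ for all α, β ∈ Λ^{n,0}_{j_a}E*. Moreover Ψ_{j_a,j_b} is a ℂ-linear isomorphism, and for every compatible positive complex structure j one has Ψ_{j,j} = id. -/
open Complex

noncomputable section

variable {E : Type*} [AddCommGroup E] [Module ℝ E]

/-- The defining property of `Ψ_{j_a,j_b}`: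
`Ψ(α) ∧ β̄ = α ∧ β̄` for all `α, β ∈ Λ^{n,0}_{j_a}E*`. -/
def PsiProp (ω : E [⋀^Fin 2]→ₗ[ℝ] ℝ) (n : ℕ) (ja jb : E →ₗ[ℝ] E)
    (Ψ : Lam ja n →ₗ[ℂ] Lam jb n) : Prop :=
  ∀ α β : Lam ja n,
    wedgeC ((Ψ α : E [⋀^Fin n]→ₗ[ℝ] ℂ)) (conjAlt (β : E [⋀^Fin n]→ₗ[ℝ] ℂ)) =
      wedgeC (α : E [⋀^Fin n]→ₗ[ℝ] ℂ) (conjAlt (β : E [⋀^Fin n]→ₗ[ℝ] ℂ))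

/-- The determinant form `f₁ ∧ ⋯ ∧ fₙ` of a finite family of `ℂ`-valued functionals. -/
def detForm {ι : Type*} [Fintype ι] [DecidableEq ι] (f : ι → E →ₗ[ℝ] ℂ) : E [⋀^ι]→ₗ[ℝ] ℂ :=
  MultilinearMap.alternatization ((MultilinearMap.mkPiAlgebra ℝ ι ℂ).compLinearMap f)

theorem detForm_apply {ι : Type*} [Fintype ι] [DecidableEq ι] (f : ι → E →ₗ[ℝ] ℂ) (v : ι → E) :
    detForm f v = (Matrix.of fun k i => f i (v k)).det := by
  simp [detForm, MultilinearMap.alternatization_apply, Matrix.det_apply]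

theorem conjAlt_detForm {n : ℕ} (f : Fin n → E →ₗ[ℝ] ℂ) :
    conjAlt (detForm f) = detForm fun i => Complex.conjAe.toLinearMap ∘ₗ f i := by
  ext v
  simp only [conjAlt, LinearMap.compAlternatingMap_apply, detForm_apply]
  exact RingHom.map_det (starRingEnd ℂ) _

theorem detForm_coprod {ι κ : Type*} [Fintype ι] [DecidableEq ι] [Fintype κ] [DecidableEq κ]
    (f : ι → E →ₗ[ℝ] ℂ) (g : κ → E →ₗ[ℝ] ℂ) :
    (LinearMap.mul' ℝ ℂ).compAlternatingMap ((detForm f).domCoprod (detForm g)) =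
      detForm (Sum.elim f g) := by
  rw [detForm, detForm, ← MultilinearMap.domCoprod_alternization,
    ← LinearMap.compMultilinearMap_alternatization, detForm]
  congr 1
  ext v
  simp [MultilinearMap.domCoprod_apply]

theorem wedgeC_detForm_apply {n : ℕ} (f g : Fin n → E →ₗ[ℝ] ℂ) (v : Fin (n + n) → E) :
    wedgeC (detForm f) (detForm g) v = detForm (Sum.elim f g) (v ∘ finSumFinEquiv) := by
  rw [wedgeC, detForm_coprod]
  rfl

/-- Two top-degree forms are proportional, provided the second one is nonzero. -/
theorem exists_eq_smul_of_top {m : ℕ} (b : Module.Basis (Fin m) ℝ E) (S T : E [⋀^Fin m]→ₗ[ℝ] ℂ)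
    (hT : T ≠ 0) : ∃ c : ℂ, S = c • T := by
  have key : ∀ f g : E [⋀^Fin m]→ₗ[ℝ] ℂ, f b = g b → f = g := by
    intro f g h
    refine Module.Basis.ext_alternating b fun i hi => ?_
    let σ : Equiv.Perm (Fin m) := Equiv.ofBijective i (Finite.injective_iff_bijective.1 hi)
    change f (b ∘ σ) = g (b ∘ σ)
    rw [AlternatingMap.map_perm, AlternatingMap.map_perm, h]
  have hTb : T b ≠ 0 := fun h => hT (key T 0 (by simpa using h))
  exact ⟨S b / T b, key _ _ (by simp [hTb])⟩

theorem detForm_basis_ne_zero {ι : Type*} [Fintype ι] [DecidableEq ι] (b : Module.Basis ι ℝ E)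
    (f : ι → E →ₗ[ℝ] ℂ) (hf : LinearIndependent ℂ f) : detForm f b ≠ 0 := by
  rw [detForm_apply]
  have h : LinearIndependent ℂ (Matrix.of fun k i => f i (b k)).col := by
    rw [Fintype.linearIndependent_iff] at hf ⊢
    intro c hc
    refine hf c (b.ext fun k => ?_)
    simpa using congrFun hc k
  exact ((Matrix.isUnit_iff_isUnit_det _).1 (Matrix.linearIndependent_cols_iff_isUnit.1 h)).ne_zero

/-- The bilinear form underlying an alternating `2`-form. -/
def bilinOfAlt (ω : E [⋀^Fin 2]→ₗ[ℝ] ℝ) : E →ₗ[ℝ] E →ₗ[ℝ] ℝ :=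
  LinearMap.mk₂ ℝ (fun x y => ω ![x, y])
    (fun x y z => ω.map_vecCons_add ![z] x y)
    (fun c x y => ω.map_vecCons_smul ![y] c x)
    (fun x y z => (ω.curryLeft x).map_vecCons_add ![] y z)
    (fun c x y => (ω.curryLeft x).map_vecCons_smul ![] c y)

theorem bilinOfAlt_apply (ω : E [⋀^Fin 2]→ₗ[ℝ] ℝ) (x y : E) : bilinOfAlt ω x y = ω ![x, y] :=
  rfl

theorem OmNondeg.exists_repr [FiniteDimensional ℝ E] {ω : E [⋀^Fin 2]→ₗ[ℝ] ℝ} (h : OmNondeg ω)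
    (u : E →ₗ[ℝ] ℝ) : ∃ p : E, ∀ x, u x = ω ![p, x] := by
  have hinj : Function.Injective (bilinOfAlt ω) := by
    rw [injective_iff_map_eq_zero]
    intro x hx
    refine h x fun y => ?_
    rw [← bilinOfAlt_apply, hx]
    rfl
  have hsurj : Function.Surjective (bilinOfAlt ω) :=
    (LinearMap.injective_iff_surjective_of_finrank_eq_finrank
      (Subspace.dual_finrank_eq (K := ℝ) (V := E)).symm).1 hinj
  obtain ⟨p, hp⟩ := hsurj u
  exact ⟨p, fun x => by rw [← bilinOfAlt_apply, hp]⟩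

/-- A functional of type `(1,0)` for one positive compatible structure and of type `(0,1)` for
another one vanishes. -/
theorem functional_eq_zero [FiniteDimensional ℝ E] {ω : E [⋀^Fin 2]→ₗ[ℝ] ℝ} (hnd : OmNondeg ω)
    {ja jb : E →ₗ[ℝ] E} (hja : IsCplxStruct ja) (hjb : IsCplxStruct jb)
    (hca : OmCompat ω ja) (hcb : OmCompat ω jb) (hpa : OmPos ω ja) (hpb : OmPos ω jb)
    (F : E →ₗ[ℝ] ℂ) (hFb : ∀ x, F (jb x) = I * F x) (hFa : ∀ x, F (ja x) = -I * F x) :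
    F = 0 := by
  obtain ⟨p, hp⟩ := hnd.exists_repr (Complex.reLm ∘ₗ F)
  have hp' : ∀ x, (F x).re = ω ![p, x] := hp
  have hsum : ja p + jb p = 0 := by
    refine hnd _ fun y => ?_
    have ha : ω ![ja p, y] = -(F (ja y)).re := by
      rw [← hca, hja, hp', ← bilinOfAlt_apply, map_neg, LinearMap.neg_apply, bilinOfAlt_apply]
    have hb : ω ![jb p, y] = -(F (jb y)).re := by
      rw [← hcb, hjb, hp', ← bilinOfAlt_apply, map_neg, LinearMap.neg_apply, bilinOfAlt_apply]
    rw [← bilinOfAlt_apply, map_add, LinearMap.add_apply, bilinOfAlt_apply, bilinOfAlt_apply,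
      ha, hb, hFa, hFb]
    simp
  have hp0 : p = 0 := by
    by_contra hne
    have h1 := hpa p hne
    have h2 := hpb p hne
    have h3 : ω ![p, ja p] + ω ![p, jb p] = 0 := by
      simp only [← bilinOfAlt_apply, ← map_add, hsum, map_zero]
    linarith
  have hre : ∀ x, (F x).re = 0 := fun x => by
    rw [hp', hp0, ← bilinOfAlt_apply, map_zero, LinearMap.zero_apply]
  ext x
  refine Complex.ext (hre x) ?_
  have h := hre (jb x)
  rw [hFb] at h
  simpa using h

theorem linearIndependent_sumElim_conj [FiniteDimensional ℝ E] {ω : E [⋀^Fin 2]→ₗ[ℝ] ℝ}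
    (hnd : OmNondeg ω) {ja jb : E →ₗ[ℝ] E} (hja : IsCplxStruct ja) (hjb : IsCplxStruct jb)
    (hca : OmCompat ω ja) (hcb : OmCompat ω jb) (hpa : OmPos ω ja) (hpb : OmPos ω jb)
    {ι : Type*} [Fintype ι] (f g : ι → E →ₗ[ℝ] ℂ) (hf : LinearIndependent ℂ f)
    (hg : LinearIndependent ℂ g) (hfb : ∀ i x, f i (jb x) = I * f i x)
    (hga : ∀ i x, g i (ja x) = I * g i x) :
    LinearIndependent ℂ (Sum.elim f fun i => Complex.conjAe.toLinearMap ∘ₗ g i) := by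
  rw [Fintype.linearIndependent_iff] at hf hg ⊢
  intro c hc
  rw [Fintype.sum_sum_type] at hc
  simp only [Sum.elim_inl, Sum.elim_inr] at hc
  have hpt : ∀ x, ∑ i, c (Sum.inl i) * f i x
      + ∑ i, c (Sum.inr i) * (starRingEnd ℂ) (g i x) = 0 := by
    intro x
    simpa using LinearMap.congr_fun hc x
  have hF : ∑ i, c (Sum.inl i) • f i = 0 := by
    refine functional_eq_zero hnd hja hjb hca hcb hpa hpb _ (fun x => ?_) fun x => ?_
    · simp only [LinearMap.sum_apply, LinearMap.smul_apply, hfb, smul_eq_mul, Finset.mul_sum]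
      exact Finset.sum_congr rfl fun i _ => by ring
    · have h1 := eq_neg_of_add_eq_zero_left (hpt (ja x))
      have h2 := eq_neg_of_add_eq_zero_left (hpt x)
      simp only [LinearMap.sum_apply, LinearMap.smul_apply, smul_eq_mul]
      rw [h1, h2, mul_neg, Finset.mul_sum]
      congr 1
      refine Finset.sum_congr rfl fun i _ => ?_
      rw [hga, map_mul, Complex.conj_I]
      ring
  have hG : ∑ i, (starRingEnd ℂ) (c (Sum.inr i)) • g i = 0 := by
    ext x
    have h := hpt x
    have h0 : ∑ i, c (Sum.inl i) * f i x = 0 := by simpa using LinearMap.congr_fun hF x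
    rw [h0, zero_add] at h
    have := congrArg (starRingEnd ℂ) h
    simpa using this
  rintro (i | i)
  · exact hf _ hF i
  · simpa using hg _ hG i

theorem detForm_mem_Lam {j : E →ₗ[ℝ] E} {n : ℕ} {f : Fin n → E →ₗ[ℝ] ℂ}
    (hf : ∀ i x, f i (j x) = I * f i x) : detForm f ∈ Lam j n := by
  intro v i _
  rw [detForm_apply, detForm_apply, ← Matrix.updateRow_eq_self
    (Matrix.of fun k i => f i (v k)) i, ← Matrix.det_updateRow_smul]
  congr 1
  ext k l
  by_cases h : k = i
  · subst h
    simp [hf]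
  · simp [h]

/-- A form which is `ℂ`-linear in its first argument is `ℂ`-linear in every argument. -/
theorem Lam.map_update {j : E →ₗ[ℝ] E} {n : ℕ} {α : E [⋀^Fin n]→ₗ[ℝ] ℂ} (hα : α ∈ Lam j n)
    (v : Fin n → E) (i : Fin n) : α (Function.update v i (j (v i))) = I * α v := by
  obtain hn | hn := n.eq_zero_or_pos
  · subst hn; exact i.elim0
  by_cases hi : i = ⟨0, hn⟩
  · exact hα v i (by simp [hi])
  · have h := hα (v ∘ Equiv.swap i ⟨0, hn⟩) ⟨0, hn⟩ rfl
    have e : Function.update (v ∘ Equiv.swap i ⟨0, hn⟩) ⟨0, hn⟩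
        (j ((v ∘ Equiv.swap i ⟨0, hn⟩) ⟨0, hn⟩)) =
        Function.update v i (j (v i)) ∘ Equiv.swap i ⟨0, hn⟩ := by
      rw [Function.update_comp_equiv]
      simp
    rw [e, α.map_swap _ hi, α.map_swap _ hi, mul_neg] at h
    exact neg_injective h

theorem exists_coframe_of_module [FiniteDimensional ℝ E] [Module ℂ E] [IsScalarTower ℝ ℂ E]
    {j : E →ₗ[ℝ] E} (hj : ∀ x, I • x = j x) {n : ℕ} (hdim : Module.finrank ℝ E = 2 * n) :
    ∃ f : Fin n → E →ₗ[ℝ] ℂ, LinearIndependent ℂ f ∧ (∀ i x, f i (j x) = I * f i x) ∧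
      ∀ α ∈ Lam j n, ∃ c : ℂ, α = c • detForm f := by
  have : Module.Finite ℂ E := Module.Finite.of_restrictScalars_finite ℝ ℂ E
  have hfr : Module.finrank ℂ E = n := by
    have h := Module.finrank_mul_finrank ℝ ℂ E
    rw [Complex.finrank_real_complex] at h
    omega
  let b : Module.Basis (Fin n) ℂ E := Module.finBasisOfFinrankEq ℂ E hfr
  refine ⟨fun i => (b.coord i).restrictScalars ℝ, ?_, fun i x => ?_, fun α hα => ?_⟩
  · rw [Fintype.linearIndependent_iff]
    intro c hc i
    simpa [Finsupp.single_apply] using LinearMap.congr_fun hc (b i)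
  · simp [← hj]
  · let A : E [⋀^Fin n]→ₗ[ℂ] ℂ :=
      { toFun := α
        map_update_add' := by
          intro _ v i x y
          convert α.map_update_add v i x y
        map_update_smul' := by
          intro inst v i c x
          have := Subsingleton.elim inst (instDecidableEqFin n)
          subst this
          have hI : α (Function.update v i (I • x)) = I * α (Function.update v i x) := by
            have := Lam.map_update hα (Function.update v i x) i
            rwa [Function.update_self, Function.update_idem, ← hj] at this
          have hc : c • x = c.re • x + c.im • (I • x) := by
            conv_lhs => rw [← Complex.re_add_im c]
            rw [add_smul, mul_smul]
            exact congrArg₂ (· + ·) (algebraMap_smul ℂ c.re x) (algebraMap_smul ℂ c.im (I • x))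
          rw [hc, α.map_update_add, α.map_update_smul, α.map_update_smul, hI]
          simp only [Complex.real_smul, smul_eq_mul]
          linear_combination α (Function.update v i x) * Complex.re_add_im c
        map_eq_zero_of_eq' := α.map_eq_zero_of_eq' }
    refine ⟨A b, ?_⟩
    ext v
    have h := congrArg (fun B : E [⋀^Fin n]→ₗ[ℂ] ℂ => B v) (A.eq_smul_basis_det b)
    change α v = _ at h
    rw [h, AlternatingMap.smul_apply, AlternatingMap.smul_apply, detForm_apply,
      Module.Basis.det_apply, ← Matrix.det_transpose]
    rfl

theorem exists_coframe [FiniteDimensional ℝ E] {j : E →ₗ[ℝ] E} (hj : IsCplxStruct j) {n : ℕ}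
    (hdim : Module.finrank ℝ E = 2 * n) :
    ∃ f : Fin n → E →ₗ[ℝ] ℂ, LinearIndependent ℂ f ∧ (∀ i x, f i (j x) = I * f i x) ∧
      ∀ α ∈ Lam j n, ∃ c : ℂ, α = c • detForm f := by
  have hjj : (j : Module.End ℝ E) * j = -1 := LinearMap.ext hj
  let _ : Module ℂ E := Module.compHom E (Complex.liftAux (A := Module.End ℝ E) j hjj).toRingHom
  have hs : ∀ (c : ℂ) (x : E), c • x = Complex.liftAux (A := Module.End ℝ E) j hjj c x :=
    fun _ _ => rfl
  have : IsScalarTower ℝ ℂ E := ⟨fun r c x => by simp only [hs, map_smul, LinearMap.smul_apply]⟩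
  exact exists_coframe_of_module (fun x => by rw [hs, Complex.liftAux_apply_I]) hdim

theorem wedgeC_conj_detForm_ne_zero [FiniteDimensional ℝ E] {ω : E [⋀^Fin 2]→ₗ[ℝ] ℝ}
    (hnd : OmNondeg ω) {n : ℕ} (b : Module.Basis (Fin (n + n)) ℝ E)
    {ja jb : E →ₗ[ℝ] E} (hja : IsCplxStruct ja) (hjb : IsCplxStruct jb)
    (hca : OmCompat ω ja) (hcb : OmCompat ω jb) (hpa : OmPos ω ja) (hpb : OmPos ω jb)
    (f g : Fin n → E →ₗ[ℝ] ℂ) (hf : LinearIndependent ℂ f)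
    (hg : LinearIndependent ℂ g) (hfb : ∀ i x, f i (jb x) = I * f i x)
    (hga : ∀ i x, g i (ja x) = I * g i x) :
    wedgeC (detForm f) (conjAlt (detForm g)) ≠ 0 := by
  intro h
  have h1 := congrArg (fun T : E [⋀^Fin (n + n)]→ₗ[ℝ] ℂ => T b) h
  simp only [conjAlt_detForm, wedgeC_detForm_apply, AlternatingMap.zero_apply] at h1
  refine detForm_basis_ne_zero (b.reindex finSumFinEquiv.symm) _
    (linearIndependent_sumElim_conj hnd hja hjb hca hcb hpa hpb f g hf hg hfb hga) ?_
  rw [← h1]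
  congr 1
  ext i
  simp

/-- Generators of the lines `Λ^{n,0}` for `ja` and `jb`, with nonzero wedge pairing. -/
theorem exists_generator [FiniteDimensional ℝ E] {ω : E [⋀^Fin 2]→ₗ[ℝ] ℝ}
    (hnd : OmNondeg ω) {n : ℕ} (hdim : Module.finrank ℝ E = 2 * n)
    {ja jb : E →ₗ[ℝ] E} (hja : IsCplxStruct ja) (hjb : IsCplxStruct jb)
    (hca : OmCompat ω ja) (hcb : OmCompat ω jb) (hpa : OmPos ω ja) (hpb : OmPos ω jb) :
    ∃ α₀ : Lam ja n, ∃ γ₀ : Lam jb n, ∃ c : ℂ, c ≠ 0 ∧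
      wedgeC (γ₀ : E [⋀^Fin n]→ₗ[ℝ] ℂ) (conjAlt (α₀ : E [⋀^Fin n]→ₗ[ℝ] ℂ)) ≠ 0 ∧
      wedgeC (α₀ : E [⋀^Fin n]→ₗ[ℝ] ℂ) (conjAlt (α₀ : E [⋀^Fin n]→ₗ[ℝ] ℂ)) =
        c • wedgeC (γ₀ : E [⋀^Fin n]→ₗ[ℝ] ℂ) (conjAlt (α₀ : E [⋀^Fin n]→ₗ[ℝ] ℂ)) ∧
      (∀ α : Lam ja n, ∃ z : ℂ, α = z • α₀) ∧ ∀ γ : Lam jb n, ∃ z : ℂ, γ = z • γ₀ := by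
  obtain ⟨g, hg, hga, hgen⟩ := exists_coframe hja hdim
  obtain ⟨f, hf, hfb, hfen⟩ := exists_coframe hjb hdim
  let b : Module.Basis (Fin (n + n)) ℝ E := Module.finBasisOfFinrankEq ℝ E (by omega)
  have h1 := wedgeC_conj_detForm_ne_zero hnd b hja hjb hca hcb hpa hpb f g hf hg hfb hga
  have h2 := wedgeC_conj_detForm_ne_zero hnd b hja hja hca hca hpa hpa g g hg hg hga hga
  obtain ⟨c, hc⟩ := exists_eq_smul_of_top b
    (wedgeC (detForm g) (conjAlt (detForm g))) (wedgeC (detForm f) (conjAlt (detForm g))) h1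
  refine ⟨⟨detForm g, detForm_mem_Lam hga⟩, ⟨detForm f, detForm_mem_Lam hfb⟩, c, ?_, h1, hc,
    fun α => ?_, fun γ => ?_⟩
  · rintro rfl
    exact h2 (by rw [hc, zero_smul])
  · obtain ⟨z, hz⟩ := hgen α α.2
    exact ⟨z, Subtype.ext hz⟩
  · obtain ⟨z, hz⟩ := hfen γ γ.2
    exact ⟨z, Subtype.ext hz⟩

theorem exists_bijective_psi [FiniteDimensional ℝ E] {ω : E [⋀^Fin 2]→ₗ[ℝ] ℝ}
    (hnd : OmNondeg ω) {n : ℕ} (hdim : Module.finrank ℝ E = 2 * n)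
    {ja jb : E →ₗ[ℝ] E} (hja : IsCplxStruct ja) (hjb : IsCplxStruct jb)
    (hca : OmCompat ω ja) (hcb : OmCompat ω jb) (hpa : OmPos ω ja) (hpb : OmPos ω jb) :
    ∃ Ψ₀ : Lam ja n →ₗ[ℂ] Lam jb n, Function.Bijective Ψ₀ ∧ PsiProp ω n ja jb Ψ₀ ∧
      ∀ Ψ : Lam ja n →ₗ[ℂ] Lam jb n, PsiProp ω n ja jb Ψ → Ψ = Ψ₀ := by
  obtain ⟨α₀, γ₀, c, hc, hne, heq, hα, hγ⟩ :=
    exists_generator hnd hdim hja hjb hca hcb hpa hpb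
  have hα₀ : α₀ ≠ 0 := by
    rintro rfl
    apply hne
    have h := wedgeC_smul_smul 1 0 γ₀.1 (0 : E [⋀^Fin n]→ₗ[ℝ] ℂ)
    have h0 := conjAlt_smul 0 (0 : E [⋀^Fin n]→ₗ[ℝ] ℂ)
    rw [map_zero, zero_smul, zero_smul] at h0
    rw [Submodule.coe_zero, h0]
    simpa using h
  have hγ₀ : γ₀ ≠ 0 := by
    rintro rfl
    apply hne
    have h := wedgeC_smul_smul 0 1 (0 : E [⋀^Fin n]→ₗ[ℝ] ℂ) (conjAlt α₀.1)
    simpa using h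
  choose z hz using hα
  have hzu : ∀ {x y : ℂ}, x • α₀ = y • α₀ → x = y := fun h => smul_left_injective ℂ hα₀ h
  let Ψ₀ : Lam ja n →ₗ[ℂ] Lam jb n :=
    { toFun := fun α => (z α * c) • γ₀
      map_add' := fun x y => by
        have : z (x + y) = z x + z y := hzu (by rw [add_smul, ← hz, ← hz, ← hz])
        rw [this, add_mul, add_smul]
      map_smul' := fun r x => by
        have : z (r • x) = r * z x := hzu (by rw [mul_smul, ← hz, ← hz])
        rw [this, mul_assoc, mul_smul, RingHom.id_apply] }
  have hΨ₀ : ∀ α, Ψ₀ α = (z α * c) • γ₀ := fun _ => rfl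
  have wedge : ∀ {j : E →ₗ[ℝ] E} (u w : ℂ) (γ : Lam j n),
      wedgeC ((u • γ : Lam j n) : E [⋀^Fin n]→ₗ[ℝ] ℂ)
        (conjAlt ((w • α₀ : Lam ja n) : E [⋀^Fin n]→ₗ[ℝ] ℂ)) =
      (u * (starRingEnd ℂ) w) • wedgeC γ.1 (conjAlt α₀.1) := fun u w γ => by
    rw [Submodule.coe_smul, Submodule.coe_smul, conjAlt_smul, wedgeC_smul_smul]
  refine ⟨Ψ₀, ⟨fun x y h => ?_, fun γ => ?_⟩, fun α β => ?_, fun Ψ hΨ => ?_⟩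
  · rw [hΨ₀, hΨ₀] at h
    rw [hz x, hz y, mul_right_cancel₀ hc (smul_left_injective ℂ hγ₀ h)]
  · obtain ⟨w, rfl⟩ := hγ γ
    refine ⟨(w / c) • α₀, ?_⟩
    have : z ((w / c) • α₀) = w / c := hzu (hz _).symm
    rw [hΨ₀, this, div_mul_cancel₀ _ hc]
  · rw [hΨ₀, hz β, wedge, hz α, wedge, heq, smul_smul, ← hz α]
    congr 1
    ring
  · ext1 α
    obtain ⟨w, hw⟩ := hγ (Ψ α)
    have h : wedgeC (Ψ α).1 (conjAlt ((1 : ℂ) • α₀).1) = wedgeC α.1 (conjAlt ((1 : ℂ) • α₀).1) :=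
      hΨ α _
    have hw' : w * (starRingEnd ℂ) 1 = z α * (starRingEnd ℂ) 1 * c := by
      refine smul_left_injective ℂ hne ?_
      change (w * (starRingEnd ℂ) 1) • _ = _ • _
      rw [mul_smul _ c, ← heq, ← wedge, ← wedge, ← hw, ← hz, h]
    rw [hw, hΨ₀]
    simpa using congrArg (· • γ₀) hw'

/-- existence and uniqueness of `Ψ_{j_a,j_b}`; it is a `ℂ`-linear
isomorphism, and `Ψ_{j,j} = id`. -/
theorem statement1 {E : Type*} [AddCommGroup E] [Module ℝ E] [FiniteDimensional ℝ E]
    (n : ℕ) (hn : 0 < n) (ω : E [⋀^Fin 2]→ₗ[ℝ] ℝ)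
    (hdim : Module.finrank ℝ E = 2 * n) (hnd : OmNondeg ω)
    (ja jb : E →ₗ[ℝ] E) (hja : IsCplxStruct ja) (hjb : IsCplxStruct jb)
    (hca : OmCompat ω ja) (hcb : OmCompat ω jb)
    (hpa : OmPos ω ja) (hpb : OmPos ω jb) :
    (∃! Ψ : Lam ja n →ₗ[ℂ] Lam jb n, PsiProp ω n ja jb Ψ) ∧
    (∀ Ψ : Lam ja n →ₗ[ℂ] Lam jb n, PsiProp ω n ja jb Ψ → Function.Bijective Ψ) ∧
    (∀ j : E →ₗ[ℝ] E, IsCplxStruct j → OmCompat ω j → OmPos ω j →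
      ∀ Ψ : Lam j n →ₗ[ℂ] Lam j n, PsiProp ω n j j Ψ → Ψ = LinearMap.id) := by
  obtain ⟨Ψ₀, hbij, hΨ₀, huniq⟩ := exists_bijective_psi hnd hdim hja hjb hca hcb hpa hpb
  refine ⟨⟨Ψ₀, hΨ₀, huniq⟩, fun Ψ hΨ => ?_, fun j hj hc hp Ψ hΨ => ?_⟩
  · rw [huniq Ψ hΨ]
    exact hbij
  · obtain ⟨Φ, -, -, hΦ⟩ := exists_bijective_psi hnd hdim hj hj hc hc hp hp
    rw [hΦ Ψ hΨ, ← hΦ LinearMap.id fun _ _ => rfl]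

end
end

section
/- Let j₀, j_a, j_b, j_c be compatible positive complex structures on (E, ω), with associated maps μ_a, μ_b, μ_c : Λ^{1,0}_{j₀}E* → Λ^{0,1}_{j₀}E* (the maps whose graphs are Λ^{1,0}_{j_a}E*, Λ^{1,0}_{j_b}E*, Λ^{1,0}_{j_c}E* respectively). Then ζ(j_a,j_b,j_c) = [det M(μ_a, μ_b) · det M(μ_b, μ_c)] / [det M(μ_a, μ_c) · det M(μ_b, μ_b)], where the determinants are those of ℂ-linear endomorphisms of E* ⊗ ℂ and the denominators are nonzero. -/
open Complex

noncomputable section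

variable {E : Type*} [AddCommGroup E] [Module ℝ E]

/-- `Λ^{1,0}_j E*`: `ℂ`-valued `ℝ`-linear forms with `α (j v) = i · α v`. -/
def Lam10 (j : E →ₗ[ℝ] E) : Submodule ℂ (E →ₗ[ℝ] ℂ) where
  carrier := {α | ∀ x : E, α (j x) = Complex.I * α x}
  add_mem' := by
    intro a b ha hb x
    simp only [LinearMap.add_apply, ha x, hb x]; ring
  zero_mem' := by intro x; simp
  smul_mem' := by
    intro c a ha x
    simp only [LinearMap.smul_apply, ha x, smul_eq_mul]; ring

/-- `Λ^{0,1}_j E*`: `ℂ`-valued `ℝ`-linear forms with `α (j v) = -i · α v`. -/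
def Lam01 (j : E →ₗ[ℝ] E) : Submodule ℂ (E →ₗ[ℝ] ℂ) where
  carrier := {α | ∀ x : E, α (j x) = -(Complex.I * α x)}
  add_mem' := by
    intro a b ha hb x
    simp only [LinearMap.add_apply, ha x, hb x]; ring
  zero_mem' := by intro x; simp
  smul_mem' := by
    intro c a ha x
    simp only [LinearMap.smul_apply, ha x, smul_eq_mul]; ring

/-- The conjugate of a `ℂ`-valued `ℝ`-linear form. -/
def conjForm (α : E →ₗ[ℝ] ℂ) : E →ₗ[ℝ] ℂ :=
  Complex.conjAe.toLinearMap ∘ₗ α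

/-- The endomorphism `M(μ, ν)` of `E* ⊗ ℂ ≃ Λ^{1,0}_{j₀}E* ⊕ Λ^{0,1}_{j₀}E*`,
`(α, β) ↦ (α + μ̄(β), ν(α) + β)`, expressed relative to the splitting
(with `μ̄` given as the first argument). -/
def Mmat (j₀ : E →ₗ[ℝ] E) (μbar : Lam01 j₀ →ₗ[ℂ] Lam10 j₀)
    (ν : Lam10 j₀ →ₗ[ℂ] Lam01 j₀) :
    (Lam10 j₀ × Lam01 j₀) →ₗ[ℂ] (Lam10 j₀ × Lam01 j₀) :=
  LinearMap.prod
    (LinearMap.fst ℂ (Lam10 j₀) (Lam01 j₀) +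
      μbar ∘ₗ LinearMap.snd ℂ (Lam10 j₀) (Lam01 j₀))
    (ν ∘ₗ LinearMap.fst ℂ (Lam10 j₀) (Lam01 j₀) +
      LinearMap.snd ℂ (Lam10 j₀) (Lam01 j₀))

/-- The alternating form `f₁ ∧ ⋯ ∧ f_p` attached to a finite family of linear forms. -/
def decForm {ι : Type*} [Fintype ι] [DecidableEq ι] (f : ι → E →ₗ[ℝ] ℂ) :
    E [⋀^ι]→ₗ[ℝ] ℂ :=
  MultilinearMap.alternatization ((MultilinearMap.mkPiAlgebra ℝ ι ℂ).compLinearMap f)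

theorem decForm_apply {ι : Type*} [Fintype ι] [DecidableEq ι] (f : ι → E →ₗ[ℝ] ℂ) (v : ι → E) :
    decForm f v = (Matrix.of fun k i => f i (v k)).det := by
  simp [decForm, MultilinearMap.alternatization_apply, Matrix.det_apply]

theorem wedgeC_decForm {p q : ℕ} (f : Fin p → E →ₗ[ℝ] ℂ) (g : Fin q → E →ₗ[ℝ] ℂ) :
    wedgeC (decForm f) (decForm g) =
      (decForm (Sum.elim f g)).domDomCongr finSumFinEquiv := by
  unfold wedgeC decForm
  rw [← MultilinearMap.domCoprod_alternization, ← LinearMap.compMultilinearMap_alternatization]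
  congr 2
  ext v
  simp [MultilinearMap.domCoprod]

theorem conjAlt_decForm {p : ℕ} (f : Fin p → E →ₗ[ℝ] ℂ) :
    conjAlt (decForm f) = decForm fun i => conjForm (f i) := by
  unfold conjAlt decForm
  rw [← LinearMap.compMultilinearMap_alternatization]
  congr 1
  ext v
  simp [conjForm]

theorem wedgeC_smul_left {p q : ℕ} (c : ℂ) (α : E [⋀^Fin p]→ₗ[ℝ] ℂ) (β : E [⋀^Fin q]→ₗ[ℝ] ℂ) :
    wedgeC (c • α) β = c • wedgeC α β := by
  ext v
  simp only [wedgeC, AlternatingMap.domDomCongr_apply, LinearMap.compAlternatingMap_apply,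
    AlternatingMap.domCoprod_apply, AlternatingMap.smul_apply, _root_.sum_apply, map_sum,
    Finset.smul_sum]
  refine Finset.sum_congr rfl fun σ _ => ?_
  induction σ using Quotient.inductionOn' with
  | h σ =>
    simp [AlternatingMap.domCoprod.summand_mk'', mul_assoc, mul_smul_comm]

theorem decForm_mem_Lam {j : E →ₗ[ℝ] E} {n : ℕ} {f : Fin n → E →ₗ[ℝ] ℂ}
    (hf : ∀ i, f i ∈ Lam10 j) : decForm f ∈ Lam j n := by
  intro v i _
  rw [decForm_apply, decForm_apply]
  have h := Matrix.det_updateRow_smul (Matrix.of fun k i => f i (v k)) i I fun m => f m (v i)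
  rw [show (fun m => f m (v i)) = (Matrix.of fun k i => f i (v k)) i from rfl,
    Matrix.updateRow_eq_self] at h
  rw [← h]
  congr 1
  ext k m
  by_cases hk : k = i
  · subst hk
    simpa using hf m (v k)
  · simp [hk]

theorem Lam01_eq_Lam10_neg (j : E →ₗ[ℝ] E) : Lam01 j = Lam10 (-j) := by
  ext α
  change (∀ x, α (j x) = -(I * α x)) ↔ ∀ x, α (-(j x)) = I * α x
  simp [neg_eq_iff_eq_neg]

theorem IsCplxStruct.neg {j : E →ₗ[ℝ] E} (hj : IsCplxStruct j) : IsCplxStruct (-j) := by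
  intro x
  simp [hj x]

/-- The form of type `(1,0)` with real part `l`. -/
def toLam10 {j : E →ₗ[ℝ] E} (hj : IsCplxStruct j) (l : E →ₗ[ℝ] ℝ) : Lam10 j :=
  ⟨{ toFun := fun x => (l x : ℂ) - I * l (j x)
     map_add' := by intro x y; simp; ring
     map_smul' := by intro c x; simp; ring }, by
    intro x
    simp only [LinearMap.coe_mk, AddHom.coe_mk, hj x, map_neg, ofReal_neg]
    linear_combination (l (j x) : ℂ) * I_mul_I⟩

theorem eq_zero_of_forall_Lam10 {j : E →ₗ[ℝ] E} (hj : IsCplxStruct j) {x : E}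
    (h : ∀ γ ∈ Lam10 j, γ x = 0) : x = 0 := by
  refine (Module.forall_dual_apply_eq_zero_iff ℝ x).1 fun l => ?_
  simpa [toLam10] using congrArg re (h _ (toLam10 hj l).2)

theorem finrank_Lam10 [FiniteDimensional ℝ E] {j : E →ₗ[ℝ] E} (hj : IsCplxStruct j) {n : ℕ}
    (hdim : Module.finrank ℝ E = 2 * n) : Module.finrank ℂ (Lam10 j) = n := by
  have h := finrank_real_of_complex (Lam10 j)
  let _ : Module ℝ (Lam10 j) := Module.complexToReal (Lam10 j)
  have hre (γ : Lam10 j) (x : E) : (γ : E →ₗ[ℝ] ℂ) x =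
      (((γ : E →ₗ[ℝ] ℂ) x).re : ℂ) - I * (((γ : E →ₗ[ℝ] ℂ) (j x)).re : ℂ) := by
    rw [γ.2 x]
    apply Complex.ext <;> simp
  have φ : Module.Dual ℝ E ≃ₗ[ℝ] Lam10 j :=
    { toFun := toLam10 hj
      invFun := fun γ => Complex.reLm ∘ₗ (γ : E →ₗ[ℝ] ℂ)
      map_add' := by
        intro l m
        ext x
        simp [toLam10]
        ring
      map_smul' := by
        intro c l
        ext x
        change ((c * l x : ℝ) : ℂ) - I * (c * l (j x) : ℝ) = (c : ℂ) * (l x - I * l (j x))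
        push_cast
        ring
      left_inv := by
        intro l
        ext x
        simp [toLam10]
      right_inv := by
        intro γ
        ext x
        exact (hre γ x).symm }
  rw [← φ.finrank_eq, Subspace.dual_finrank_eq, hdim] at h
  omega

theorem Lam10_inf_Lam01 {j : E →ₗ[ℝ] E} {γ : E →ₗ[ℝ] ℂ} (h : γ ∈ Lam10 j) (h' : γ ∈ Lam01 j) :
    γ = 0 := by
  ext x
  have h1 := h x
  rw [h' x] at h1
  simpa [neg_eq_iff_add_eq_zero, ← two_mul] using h1

theorem conjForm_mem_Lam01 {j : E →ₗ[ℝ] E} {γ : E →ₗ[ℝ] ℂ} (h : γ ∈ Lam10 j) :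
    conjForm γ ∈ Lam01 j := by
  intro x
  simp [conjForm, h x]

theorem conjForm_mem_Lam10 {j : E →ₗ[ℝ] E} {γ : E →ₗ[ℝ] ℂ} (h : γ ∈ Lam01 j) :
    conjForm γ ∈ Lam10 j := by
  intro x
  simp [conjForm, h x]

theorem conjForm_conjForm (γ : E →ₗ[ℝ] ℂ) : conjForm (conjForm γ) = γ := by
  ext x
  simp [conjForm]

theorem conjForm_add (γ δ : E →ₗ[ℝ] ℂ) : conjForm (γ + δ) = conjForm γ + conjForm δ := by
  ext x
  simp [conjForm]

theorem map_update_of_mem_Lam {j : E →ₗ[ℝ] E} {n : ℕ} {α : E [⋀^Fin n]→ₗ[ℝ] ℂ}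
    (hα : α ∈ Lam j n) (v : Fin n → E) (i : Fin n) (x : E) :
    α (Function.update v i (j x)) = I * α (Function.update v i x) := by
  have h0 : 0 < n := i.pos
  have key (w : Fin n → E) (y : E) : α (Function.update w ⟨0, h0⟩ (j y)) =
      I * α (Function.update w ⟨0, h0⟩ y) := by
    simpa using hα (Function.update w ⟨0, h0⟩ y) ⟨0, h0⟩ rfl
  by_cases hi : i = ⟨0, h0⟩
  · subst hi
    exact key v x
  · have hswap (y : E) : α (Function.update v i y) =
        -α (Function.update (v ∘ Equiv.swap i ⟨0, h0⟩) ⟨0, h0⟩ y) := by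
      rw [← neg_eq_iff_eq_neg, ← α.map_swap _ hi, Function.update_comp_equiv]
      simp
    rw [hswap, hswap, key]
    ring

theorem exists_eq_smul_decForm [FiniteDimensional ℝ E] {j : E →ₗ[ℝ] E} {n : ℕ}
    (hdim : Module.finrank ℝ E = 2 * n) {f : Fin n → E →ₗ[ℝ] ℂ}
    (hf : ∀ i, f i ∈ Lam10 j) (hsep : ∀ x, (∀ i, f i x = 0) → x = 0)
    {α : E [⋀^Fin n]→ₗ[ℝ] ℂ} (hα : α ∈ Lam j n) : ∃ c : ℂ, α = c • decForm f := by
  have hinj : Function.Injective (LinearMap.pi f) := by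
    rw [← LinearMap.ker_eq_bot, LinearMap.ker_eq_bot']
    exact fun x hx => hsep x fun i => congrFun hx i
  have hfin : Module.finrank ℝ E = Module.finrank ℝ (Fin n → ℂ) := by
    rw [hdim, finrank_real_of_complex]
    simp
  let F : E ≃ₗ[ℝ] (Fin n → ℂ) := LinearEquiv.ofInjectiveOfFinrankEq (LinearMap.pi f) hinj hfin
  have hF (x : E) (i : Fin n) : F x i = f i x := rfl
  have hFsmul (c : ℂ) (w : Fin n → ℂ) :
      F.symm (c • w) = c.re • F.symm w + c.im • j (F.symm w) := by
    rw [F.symm_apply_eq]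
    ext i
    have hw : f i (F.symm w) = w i := by rw [← hF, F.apply_symm_apply]
    rw [hF, map_add, map_smul, map_smul, hf i, hw]
    simp only [Pi.smul_apply, smul_eq_mul, real_smul]
    linear_combination -w i * re_add_im c
  let A : (Fin n → ℂ) [⋀^Fin n]→ₗ[ℂ] ℂ :=
    { toFun := fun w => α (F.symm ∘ w)
      map_update_add' := by
        intro inst w i x y
        obtain rfl : inst = instDecidableEqFin n := Subsingleton.elim _ _
        simp [Function.comp_update]
      map_update_smul' := by
        intro inst w i c x
        obtain rfl : inst = instDecidableEqFin n := Subsingleton.elim _ _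
        rw [Function.comp_update, Function.comp_update, hFsmul, α.map_update_add,
          α.map_update_smul, α.map_update_smul, map_update_of_mem_Lam hα]
        simp only [smul_eq_mul, real_smul]
        linear_combination α (Function.update (F.symm ∘ w) i (F.symm x)) * re_add_im c
      map_eq_zero_of_eq' := by
        intro w i k h hik
        exact α.map_eq_zero_of_eq _ (by simp [h]) hik }
  refine ⟨A (Pi.basisFun ℂ (Fin n)), ?_⟩
  ext v
  have h : α v = A (F ∘ v) := by
    change α v = α (F.symm ∘ F ∘ v)
    congr 1
    ext k
    simp
  rw [h, A.eq_smul_basis_det (Pi.basisFun ℂ (Fin n)), AlternatingMap.smul_apply,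
    AlternatingMap.smul_apply, Pi.basisFun_det_apply, decForm_apply]
  simp only [AlternatingMap.smul_apply, Module.Basis.det_self, smul_eq_mul, mul_one]
  rfl

theorem AlternatingMap.map_comp_eq_det_mul {V ι : Type*} [AddCommGroup V] [Module ℂ V]
    [FiniteDimensional ℂ V] [Fintype ι] [DecidableEq ι]
    (hV : Module.finrank ℂ V = Fintype.card ι) (T : V [⋀^ι]→ₗ[ℂ] ℂ) (g : V →ₗ[ℂ] V) (v : ι → V) :
    T (g ∘ v) = LinearMap.det g * T v := by
  let B : Module.Basis ι ℂ V :=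
    (Module.finBasisOfFinrankEq ℂ V hV).reindex (Fintype.equivFin ι).symm
  rw [T.eq_smul_basis_det B]
  simp only [AlternatingMap.smul_apply, B.det_comp, smul_eq_mul]
  ring

/-- The conjugation map from forms of type `(1,0)` to forms of type `(0,1)`. -/
def conj10 {j : E →ₗ[ℝ] E} (γ : Lam10 j) : Lam01 j :=
  ⟨conjForm γ, conjForm_mem_Lam01 γ.2⟩

/-- The family `eᵢ + μ eᵢ` of forms obtained by deforming `e` along `μ`. -/
def deform {j : E →ₗ[ℝ] E} {n : ℕ} (e : Fin n → Lam10 j) (μ : Lam10 j →ₗ[ℂ] Lam01 j)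
    (i : Fin n) : E →ₗ[ℝ] ℂ :=
  (e i : E →ₗ[ℝ] ℂ) + (μ (e i) : E →ₗ[ℝ] ℂ)

theorem decForm_deform [FiniteDimensional ℝ E] {j : E →ₗ[ℝ] E} (hj : IsCplxStruct j) {n : ℕ}
    (hdim : Module.finrank ℝ E = 2 * n) (e : Fin n → Lam10 j) (μ ν : Lam10 j →ₗ[ℂ] Lam01 j)
    (μbar : Lam01 j →ₗ[ℂ] Lam10 j)
    (hμ : ∀ (α : Lam01 j) (β : Lam10 j), (β : E →ₗ[ℝ] ℂ) = conjForm (α : E →ₗ[ℝ] ℂ) →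
      (μbar α : E →ₗ[ℝ] ℂ) = conjForm (μ β : E →ₗ[ℝ] ℂ)) :
    decForm (Sum.elim (deform e ν) fun i => conjForm (deform e μ i)) =
      LinearMap.det (Mmat j μbar ν) • decForm (Sum.elim (fun i => (e i : E →ₗ[ℝ] ℂ))
        fun i => conjForm (e i : E →ₗ[ℝ] ℂ)) := by
  have h01 : Module.finrank ℂ (Lam01 j) = n := by
    rw [Lam01_eq_Lam10_neg, finrank_Lam10 hj.neg hdim]
  have hV : Module.finrank ℂ (Lam10 j × Lam01 j) = Fintype.card (Fin n ⊕ Fin n) := by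
    simp [finrank_Lam10 hj hdim, h01]
  ext v
  let L : (Lam10 j × Lam01 j) →ₗ[ℂ] (Fin n ⊕ Fin n → ℂ) :=
    { toFun := fun γ k => (γ.1 : E →ₗ[ℝ] ℂ) (v k) + (γ.2 : E →ₗ[ℝ] ℂ) (v k)
      map_add' := by
        intro γ δ
        ext k
        simp
        ring
      map_smul' := by
        intro c γ
        ext k
        simp
        ring }
  let T : (Lam10 j × Lam01 j) [⋀^Fin n ⊕ Fin n]→ₗ[ℂ] ℂ :=
    Matrix.detRowAlternating.compLinearMap L
  have hT := T.map_comp_eq_det_mul hV (Mmat j μbar ν)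
    (Sum.elim (fun i => (e i, 0)) fun i => (0, conj10 (e i)))
  rw [AlternatingMap.smul_apply, decForm_apply, decForm_apply, ← Matrix.det_transpose,
    ← Matrix.det_transpose (Matrix.of _), smul_eq_mul]
  convert hT using 2
  · change Matrix.det _ = Matrix.det _
    congr 1
    ext i k
    rcases i with i | i
    · simp [L, Mmat, deform]
    · have hi := hμ (conj10 (e i)) (e i) (conjForm_conjForm _).symm
      simp [L, Mmat, deform, conjForm_add, conj10, ← hi, add_comm]
  · change _ = Matrix.det _
    congr 1
    ext i k
    rcases i with i | i <;> simp [L, conj10]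

theorem decForm_sum_ne_zero [FiniteDimensional ℝ E] {j : E →ₗ[ℝ] E} {n : ℕ}
    (hdim : Module.finrank ℝ E = 2 * n) (e : Module.Basis (Fin n) ℂ (Lam10 j)) :
    decForm (Sum.elim (fun i => (e i : E →ₗ[ℝ] ℂ)) fun i => conjForm (e i : E →ₗ[ℝ] ℂ)) ≠ 0 := by
  intro h
  let v : Module.Basis (Fin n ⊕ Fin n) ℝ E :=
    (Module.finBasisOfFinrankEq ℝ E (hdim.trans (two_mul n))).reindex finSumFinEquiv.symm
  have hv := congrArg (fun α => α v) h
  simp only [decForm_apply, AlternatingMap.zero_apply] at hv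
  obtain ⟨c, hc, hc0⟩ := Matrix.exists_mulVec_eq_zero_iff.2 hv
  apply hc
  have hsum : ∑ i, c i • (Sum.elim (fun i => (e i : E →ₗ[ℝ] ℂ))
      fun i => conjForm (e i : E →ₗ[ℝ] ℂ)) i = 0 := by
    refine v.ext fun k => ?_
    have := congrFun hc0 k
    simpa [Matrix.mulVec, dotProduct, mul_comm] using this
  set a : Lam10 j := ∑ i, c (Sum.inl i) • e i with ha
  set b : Lam10 j := ∑ i, (starRingEnd ℂ) (c (Sum.inr i)) • e i with hb
  have hab : (a : E →ₗ[ℝ] ℂ) + conjForm (b : E →ₗ[ℝ] ℂ) = 0 := by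
    rw [← hsum, Fintype.sum_sum_type]
    ext x
    simp [ha, hb, conjForm]
  have ha0 : (a : E →ₗ[ℝ] ℂ) = 0 := by
    refine Lam10_inf_Lam01 a.2 ?_
    rw [eq_neg_of_add_eq_zero_left hab]
    exact neg_mem (conjForm_mem_Lam01 b.2)
  have hb0 : (b : E →ₗ[ℝ] ℂ) = 0 := by
    rw [ha0, zero_add] at hab
    rw [← conjForm_conjForm (b : E →ₗ[ℝ] ℂ), hab]
    ext x
    simp [conjForm]
  have hli := Fintype.linearIndependent_iff.1 e.linearIndependent
  ext i
  rcases i with i | i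
  · exact hli _ (Subtype.ext ha0) i
  · simpa using hli _ (Subtype.ext hb0) i

theorem deform_mem {j j' : E →ₗ[ℝ] E} {n : ℕ} (e : Fin n → Lam10 j) {μ : Lam10 j →ₗ[ℂ] Lam01 j}
    (hμ : ∀ γ : E →ₗ[ℝ] ℂ, γ ∈ Lam10 j' ↔
      ∃ α : Lam10 j, γ = (α : E →ₗ[ℝ] ℂ) + (μ α : E →ₗ[ℝ] ℂ)) (i : Fin n) :
    deform e μ i ∈ Lam10 j' :=
  (hμ _).2 ⟨e i, rfl⟩

theorem eq_zero_of_deform_eq_zero {j j' : E →ₗ[ℝ] E} (hj' : IsCplxStruct j') {n : ℕ}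
    (e : Module.Basis (Fin n) ℂ (Lam10 j)) {μ : Lam10 j →ₗ[ℂ] Lam01 j}
    (hμ : ∀ γ : E →ₗ[ℝ] ℂ, γ ∈ Lam10 j' ↔
      ∃ α : Lam10 j, γ = (α : E →ₗ[ℝ] ℂ) + (μ α : E →ₗ[ℝ] ℂ))
    {x : E} (hx : ∀ i, deform e μ i x = 0) : x = 0 := by
  refine eq_zero_of_forall_Lam10 hj' fun γ hγ => ?_
  obtain ⟨α, rfl⟩ := (hμ γ).1 hγ
  let ev : Lam10 j →ₗ[ℂ] ℂ :=
    { toFun := fun α => (α : E →ₗ[ℝ] ℂ) x + (μ α : E →ₗ[ℝ] ℂ) x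
      map_add' := by
        intro α β
        simp
        ring
      map_smul' := by
        intro c α
        simp
        ring }
  have hev : ev = 0 := e.ext hx
  exact LinearMap.congr_fun hev α

theorem Lam10_inf_Lam01_of_pos [FiniteDimensional ℝ E] {ω : E [⋀^Fin 2]→ₗ[ℝ] ℝ}
    {j j' : E →ₗ[ℝ] E} (hp : OmPos ω j) (hp' : OmPos ω j') {γ : E →ₗ[ℝ] ℂ} (h : γ ∈ Lam10 j)
    (h' : γ ∈ Lam01 j') : γ = 0 := by
  have hinj : Function.Injective (j + j') := by
    rw [← LinearMap.ker_eq_bot, LinearMap.ker_eq_bot']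
    intro x hx
    by_contra hx0
    have hpos := hp x hx0
    have hneg : ω ![x, -j' x] = -ω ![x, j' x] := by
      have h := ω.map_update_neg ![x, j' x] 1 (j' x)
      have hup (y : E) : Function.update ![x, j' x] 1 y = ![x, y] := by
        ext i
        fin_cases i <;> rfl
      rwa [hup, hup] at h
    rw [eq_neg_of_add_eq_zero_left hx, hneg] at hpos
    linarith [hp' x hx0]
  ext x
  obtain ⟨y, rfl⟩ := LinearMap.injective_iff_surjective.1 hinj x
  simp [h y, h' y]

theorem det_Mmat_ne_zero [FiniteDimensional ℝ E] {ω : E [⋀^Fin 2]→ₗ[ℝ] ℝ}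
    {j j₁ j₂ : E →ₗ[ℝ] E} (hp₁ : OmPos ω j₁) (hp₂ : OmPos ω j₂)
    {μ ν : Lam10 j →ₗ[ℂ] Lam01 j}
    (hμ : ∀ γ : E →ₗ[ℝ] ℂ, γ ∈ Lam10 j₁ ↔
      ∃ α : Lam10 j, γ = (α : E →ₗ[ℝ] ℂ) + (μ α : E →ₗ[ℝ] ℂ))
    (hν : ∀ γ : E →ₗ[ℝ] ℂ, γ ∈ Lam10 j₂ ↔
      ∃ α : Lam10 j, γ = (α : E →ₗ[ℝ] ℂ) + (ν α : E →ₗ[ℝ] ℂ))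
    {μbar : Lam01 j →ₗ[ℂ] Lam10 j}
    (hμbar : ∀ (α : Lam01 j) (β : Lam10 j), (β : E →ₗ[ℝ] ℂ) = conjForm (α : E →ₗ[ℝ] ℂ) →
      (μbar α : E →ₗ[ℝ] ℂ) = conjForm (μ β : E →ₗ[ℝ] ℂ)) :
    LinearMap.det (Mmat j μbar ν) ≠ 0 := by
  intro hdet
  refine (LinearMap.bot_lt_ker_of_det_eq_zero hdet).ne' (LinearMap.ker_eq_bot'.2 ?_)
  rintro ⟨α, β⟩ h
  obtain ⟨h1, h2⟩ := Prod.mk.inj h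
  change α + μbar β = 0 at h1
  change ν α + β = 0 at h2
  have h1' := congrArg (Subtype.val) h1
  have h2' := congrArg (Subtype.val) h2
  change (α : E →ₗ[ℝ] ℂ) + (μbar β : E →ₗ[ℝ] ℂ) = 0 at h1'
  change (ν α : E →ₗ[ℝ] ℂ) + (β : E →ₗ[ℝ] ℂ) = 0 at h2'
  let β' : Lam10 j := ⟨conjForm β, conjForm_mem_Lam10 β.2⟩
  have hβ : (μbar β : E →ₗ[ℝ] ℂ) = conjForm (μ β' : E →ₗ[ℝ] ℂ) := hμbar β β' rfl
  have hγ : (α : E →ₗ[ℝ] ℂ) + (ν α : E →ₗ[ℝ] ℂ) =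
      -conjForm ((β' : E →ₗ[ℝ] ℂ) + (μ β' : E →ₗ[ℝ] ℂ)) := by
    rw [conjForm_add, ← hβ, conjForm_conjForm, eq_neg_of_add_eq_zero_left h1',
      eq_neg_of_add_eq_zero_left h2']
    abel
  have h0 : (α : E →ₗ[ℝ] ℂ) + (ν α : E →ₗ[ℝ] ℂ) = 0 := by
    refine Lam10_inf_Lam01_of_pos hp₂ hp₁ ((hν _).2 ⟨α, rfl⟩) ?_
    rw [hγ]
    exact neg_mem (conjForm_mem_Lam01 ((hμ _).2 ⟨β', rfl⟩))
  have hα : α = 0 := by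
    refine Subtype.ext (Lam10_inf_Lam01 α.2 ?_)
    rw [eq_neg_of_add_eq_zero_left h0]
    exact neg_mem (ν α).2
  subst hα
  rw [map_zero, zero_add] at h2
  rw [h2]
  rfl

/-- In the frames attached to the graphs of `μ` and `ν`, the map `Ψ` is multiplication by the
quotient of `det M(μ, μ)` by `det M(μ, ν)`. -/
theorem PsiProp.exists_coeff [FiniteDimensional ℝ E] {ω : E [⋀^Fin 2]→ₗ[ℝ] ℝ}
    {j j₁ j₂ : E →ₗ[ℝ] E} {n : ℕ} (hdim : Module.finrank ℝ E = 2 * n) (hj : IsCplxStruct j)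
    (hj₂ : IsCplxStruct j₂) (e : Module.Basis (Fin n) ℂ (Lam10 j))
    {μ ν : Lam10 j →ₗ[ℂ] Lam01 j}
    (hμ : ∀ γ : E →ₗ[ℝ] ℂ, γ ∈ Lam10 j₁ ↔
      ∃ α : Lam10 j, γ = (α : E →ₗ[ℝ] ℂ) + (μ α : E →ₗ[ℝ] ℂ))
    (hν : ∀ γ : E →ₗ[ℝ] ℂ, γ ∈ Lam10 j₂ ↔
      ∃ α : Lam10 j, γ = (α : E →ₗ[ℝ] ℂ) + (ν α : E →ₗ[ℝ] ℂ))
    {μbar : Lam01 j →ₗ[ℂ] Lam10 j}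
    (hμbar : ∀ (α : Lam01 j) (β : Lam10 j), (β : E →ₗ[ℝ] ℂ) = conjForm (α : E →ₗ[ℝ] ℂ) →
      (μbar α : E →ₗ[ℝ] ℂ) = conjForm (μ β : E →ₗ[ℝ] ℂ))
    {Ψ : Lam j₁ n →ₗ[ℂ] Lam j₂ n} (hΨ : PsiProp ω n j₁ j₂ Ψ) :
    ∃ c : ℂ, Ψ ⟨decForm (deform e μ), decForm_mem_Lam (deform_mem e hμ)⟩ =
        c • (⟨decForm (deform e ν), decForm_mem_Lam (deform_mem e hν)⟩ : Lam j₂ n) ∧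
      c * LinearMap.det (Mmat j μbar ν) = LinearMap.det (Mmat j μbar μ) := by
  set a : Lam j₁ n := ⟨decForm (deform e μ), decForm_mem_Lam (deform_mem e hμ)⟩
  obtain ⟨c, hc⟩ := exists_eq_smul_decForm hdim (deform_mem e hν)
    (fun x hx => eq_zero_of_deform_eq_zero hj₂ e hν hx) (Ψ a).2
  refine ⟨c, Subtype.ext hc, ?_⟩
  have h := hΨ a a
  change wedgeC (Ψ a : E [⋀^Fin n]→ₗ[ℝ] ℂ) (conjAlt (decForm (deform e μ))) =
    wedgeC (decForm (deform e μ)) (conjAlt (decForm (deform e μ))) at h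
  rw [hc, wedgeC_smul_left, conjAlt_decForm, wedgeC_decForm, wedgeC_decForm,
    decForm_deform hj hdim e μ ν μbar hμbar, decForm_deform hj hdim e μ μ μbar hμbar] at h
  obtain ⟨v, hv⟩ := DFunLike.ne_iff.1 (decForm_sum_ne_zero hdim e)
  have hw := congrArg (fun α => α (v ∘ finSumFinEquiv.symm)) h
  simp only [AlternatingMap.smul_apply, AlternatingMap.domDomCongr_apply, Function.comp_assoc,
    Equiv.symm_comp_self, Function.comp_id, smul_eq_mul, ← mul_assoc] at hw
  exact mul_right_cancel₀ hv hw

/-- the formula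
`ζ(j_a,j_b,j_c) = det M(μ_a,μ_b) · det M(μ_b,μ_c) / (det M(μ_a,μ_c) · det M(μ_b,μ_b))`. -/
theorem statement10 {E : Type*} [AddCommGroup E] [Module ℝ E] [FiniteDimensional ℝ E]
    (n : ℕ) (hn : 0 < n) (ω : E [⋀^Fin 2]→ₗ[ℝ] ℝ)
    (hdim : Module.finrank ℝ E = 2 * n) (hnd : OmNondeg ω)
    (j₀ ja jb jc : E →ₗ[ℝ] E)
    (hj₀ : IsCplxStruct j₀) (hja : IsCplxStruct ja)
    (hjb : IsCplxStruct jb) (hjc : IsCplxStruct jc)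
    (hc₀ : OmCompat ω j₀) (hca : OmCompat ω ja)
    (hcb : OmCompat ω jb) (hcc : OmCompat ω jc)
    (hp₀ : OmPos ω j₀) (hpa : OmPos ω ja) (hpb : OmPos ω jb) (hpc : OmPos ω jc)
    -- the maps `μ_a, μ_b, μ_c` whose graphs are `Λ^{1,0}_{j_a}`, `Λ^{1,0}_{j_b}`, `Λ^{1,0}_{j_c}`
    (μa μb μc : Lam10 j₀ →ₗ[ℂ] Lam01 j₀)
    (hga : ∀ γ : E →ₗ[ℝ] ℂ, γ ∈ Lam10 ja ↔
      ∃ α : Lam10 j₀, γ = (α : E →ₗ[ℝ] ℂ) + ((μa α : E →ₗ[ℝ] ℂ)))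
    (hgb : ∀ γ : E →ₗ[ℝ] ℂ, γ ∈ Lam10 jb ↔
      ∃ α : Lam10 j₀, γ = (α : E →ₗ[ℝ] ℂ) + ((μb α : E →ₗ[ℝ] ℂ)))
    (hgc : ∀ γ : E →ₗ[ℝ] ℂ, γ ∈ Lam10 jc ↔
      ∃ α : Lam10 j₀, γ = (α : E →ₗ[ℝ] ℂ) + ((μc α : E →ₗ[ℝ] ℂ)))
    -- the conjugate maps `μ̄_a`, `μ̄_b`
    (μabar μbbar : Lam01 j₀ →ₗ[ℂ] Lam10 j₀)
    (hμabar : ∀ (α : Lam01 j₀) (β : Lam10 j₀),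
      (β : E →ₗ[ℝ] ℂ) = conjForm (α : E →ₗ[ℝ] ℂ) →
        ((μabar α : E →ₗ[ℝ] ℂ)) = conjForm ((μa β : E →ₗ[ℝ] ℂ)))
    (hμbbar : ∀ (α : Lam01 j₀) (β : Lam10 j₀),
      (β : E →ₗ[ℝ] ℂ) = conjForm (α : E →ₗ[ℝ] ℂ) →
        ((μbbar α : E →ₗ[ℝ] ℂ)) = conjForm ((μb β : E →ₗ[ℝ] ℂ)))
    -- the maps `Ψ` and the scalar `ζ(j_a,j_b,j_c)`
    (Ψab : Lam ja n →ₗ[ℂ] Lam jb n) (hΨab : PsiProp ω n ja jb Ψab)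
    (Ψbc : Lam jb n →ₗ[ℂ] Lam jc n) (hΨbc : PsiProp ω n jb jc Ψbc)
    (Ψac : Lam ja n →ₗ[ℂ] Lam jc n) (hΨac : PsiProp ω n ja jc Ψac)
    (z : ℂ) (hz : Ψac = z • (Ψbc ∘ₗ Ψab)) :
    LinearMap.det (Mmat j₀ μabar μc) ≠ 0 ∧
    LinearMap.det (Mmat j₀ μbbar μb) ≠ 0 ∧
    z = (LinearMap.det (Mmat j₀ μabar μb) * LinearMap.det (Mmat j₀ μbbar μc)) /
        (LinearMap.det (Mmat j₀ μabar μc) * LinearMap.det (Mmat j₀ μbbar μb)) := by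
  have hac := det_Mmat_ne_zero hpa hpc hga hgc hμabar
  have hbb := det_Mmat_ne_zero hpb hpb hgb hgb hμbbar
  have haa := det_Mmat_ne_zero hpa hpa hga hga hμabar
  refine ⟨hac, hbb, ?_⟩
  let e : Module.Basis (Fin n) ℂ (Lam10 j₀) :=
    Module.finBasisOfFinrankEq ℂ (Lam10 j₀) (finrank_Lam10 hj₀ hdim)
  obtain ⟨p, hp, hp'⟩ := hΨab.exists_coeff hdim hj₀ hjb e hga hgb hμabar
  obtain ⟨q, hq, hq'⟩ := hΨbc.exists_coeff hdim hj₀ hjc e hgb hgc hμbbar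
  obtain ⟨r, hr, hr'⟩ := hΨac.exists_coeff hdim hj₀ hjc e hga hgc hμabar
  have hne : (⟨decForm (deform e μc), decForm_mem_Lam (deform_mem e hgc)⟩ : Lam jc n) ≠ 0 := by
    intro h0
    have hd : decForm (deform e μc) = 0 := congrArg Subtype.val h0
    have hw := decForm_deform hj₀ hdim e μa μc μabar hμabar
    have hz0 := wedgeC_decForm (deform e μc) fun i => conjForm (deform e μa i)
    rw [hw, hd, ← zero_smul ℂ (0 : E [⋀^Fin n]→ₗ[ℝ] ℂ), wedgeC_smul_left, zero_smul] at hz0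
    have := (AlternatingMap.domDomCongr_eq_zero_iff _ _).1 hz0.symm
    exact smul_ne_zero hac (decForm_sum_ne_zero hdim e) this
  have hrz : r = z * (p * q) := by
    refine smul_left_injective ℂ hne ?_
    beta_reduce
    rw [← hr, hz, LinearMap.smul_apply, LinearMap.comp_apply, hp, map_smul, hq, smul_smul,
      smul_smul, mul_assoc]
  have hp0 : p ≠ 0 := by
    rintro rfl
    exact haa (by rw [← hp', zero_mul])
  rw [eq_div_iff (mul_ne_zero hac hbb)]
  refine mul_left_cancel₀ hp0 ?_
  subst hrz
  linear_combination LinearMap.det (Mmat j₀ μbbar μc) * (hr' - hp') -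
    z * p * LinearMap.det (Mmat j₀ μabar μc) * hq'

end
end
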